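/- arXiv:2012.07067 — 8 statements merged into one kernel-verified Lean document; each statement's English description precedes it below -/
import Mathlib

section
/- Let p be a prime, n ≥ 1, and let m, l, α be integers with p > m ≥ 1, p > l ≥ 1, α ≥ 0 and m·l − p·α = 1. Then in the polynomial ring ℤ[q], the polynomial [m]_q · [l]_{q^m} · Σ_{j=0}^{n−1} (−q·[α]_{q^p}·[p]_q)^j − 1 is divisible by [p]_q^n. (In particular, [m]_q is invertible modulo [p]_q^n, with the displayed expression as inverse.) -/
open Finset

/-- The `q`-integer `[N]_q = 1 + q + ⋯ + q^{N-1}` in `ℤ[q]`. -/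
noncomputable def qintZ (N : ℕ) : Polynomial ℤ := ∑ i ∈ Finset.range N, Polynomial.X ^ i

/-- The `q`-integer evaluated at `q^e`, i.e. `[N]_{q^e} = 1 + q^e + ⋯ + q^{e(N-1)}`. -/
noncomputable def qintZat (N e : ℕ) : Polynomial ℤ := ∑ i ∈ Finset.range N, Polynomial.X ^ (e * i)

theorem qintZ_mul_aux (a b : ℕ) : qintZ a * qintZat b a = qintZ (a * b) := by
  induction b with
  | zero => simp [qintZ, qintZat]
  | succ k ih =>
    have h1 : qintZat (k + 1) a = qintZat k a + Polynomial.X ^ (a * k) := by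
      simp [qintZat, Finset.sum_range_succ]
    have h2 : qintZ (a * (k + 1)) = qintZ (a * k) + Polynomial.X ^ (a * k) * qintZ a := by
      simp only [qintZ, mul_add, mul_one, Finset.sum_range_add, Finset.mul_sum, pow_add]
    rw [h1, h2, mul_add, ih, mul_comm (qintZ a) (Polynomial.X ^ (a * k))]

theorem qintZ_succ_aux (a : ℕ) : qintZ (a + 1) = 1 + Polynomial.X * qintZ a := by
  simp only [qintZ, Finset.sum_range_succ', Finset.mul_sum, pow_succ', pow_zero]
  ring

/-- Lemma 4.6 of the paper: `[m]_q · [l]_{q^m} · Σ_{j=0}^{n-1} (−q[α]_{q^p}[p]_q)^j ≡ 1 (mod [p]_q^n)`,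
so `[m]_q` is invertible modulo `[p]_q^n` with the displayed inverse. -/
theorem stmt0 (p : ℕ) (hp : p.Prime) (n : ℕ) (hn : 1 ≤ n) (m l α : ℕ)
    (hm : 1 ≤ m) (hmp : m < p) (hl : 1 ≤ l) (hlp : l < p)
    (h : (m : ℤ) * l - (p : ℤ) * α = 1) :
    (qintZ p) ^ n ∣
      qintZ m * qintZat l m *
        (∑ j ∈ Finset.range n, (-(Polynomial.X * qintZat α p * qintZ p)) ^ j) - 1 := by
  have hml : m * l = p * α + 1 := by
    zify
    linarith
  have key : qintZ m * qintZat l m = 1 - -(Polynomial.X * qintZat α p * qintZ p) := by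
    rw [qintZ_mul_aux, hml, qintZ_succ_aux, ← qintZ_mul_aux]
    ring
  rw [key, mul_neg_geom_sum]
  refine ⟨-(-(Polynomial.X * qintZat α p)) ^ n, ?_⟩
  rw [← neg_mul, mul_pow]
  ring
end

section
/- Let p be a prime, n ≥ 1, and let k = (k_1, …, k_d) be an index. Then in ℚ(q), for both • = (non-star) and • = ⋆: H̄•_{p−1}(k; q) ≡ (−q^{−p})^{wt(k)} · q^{dp} · Σ_{l ∈ ℤ_{≥0}^d, wt(l) < n} (q^{−p}[p])^{wt(l)} · b(k; l) · H•_{p−1}(rev(k + l); q) (mod [p]^n), where the sum is over all d-tuples l = (l_1, …, l_d) of non-negative integers with l_1 + ⋯ + l_d ≤ n − 1. -/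
open Finset

/-- `[N] = 1 + q + ⋯ + q^{N-1}` in `ℚ[q]`. -/
noncomputable def qiP (N : ℕ) : Polynomial ℚ := ∑ i ∈ Finset.range N, Polynomial.X ^ i

/-- `[N] = 1 + q + ⋯ + q^{N-1}` in `ℚ(q)`. -/
noncomputable def qiR (N : ℕ) : RatFunc ℚ := ∑ i ∈ Finset.range N, RatFunc.X ^ i

/-- General multiple harmonic q-sum.  `star = false` gives strict inequalities
`m ≥ m₁ > m₂ > ⋯ > m_d > 0`, `star = true` gives weak ones; `num k i` is the exponent of `q`
in the numerator attached to an entry `k` and summation variable `i`. -/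
noncomputable def MHqS (star : Bool) (num : ℕ → ℕ → ℕ) : ℕ → List ℕ → RatFunc ℚ
  | _, [] => 1
  | m, k :: ks => ∑ i ∈ Finset.Icc 1 m,
      (RatFunc.X ^ (num k i) / (qiR i) ^ k) * MHqS star num (if star then i else i - 1) ks

/-- numerator `q^{(k-1)m_a}` of the Bradley--Zhao model -/
def stdNum (k i : ℕ) : ℕ := (k - 1) * i
/-- numerator `q^{m_a}` of the conjugate model -/
def barNum (_ i : ℕ) : ℕ := i

/-- `A ≡ B (mod [p]^n)` in `ℚ(q)`:  `A − B = [p]^n f/g` with `f, g ∈ ℚ[q]`, `[p] ∤ g`. -/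
def CongMod (p n : ℕ) (A B : RatFunc ℚ) : Prop :=
  ∃ f g : Polynomial ℚ, ¬ (qiP p ∣ g) ∧
    A - B = (algebraMap (Polynomial ℚ) (RatFunc ℚ) (qiP p)) ^ n *
      (algebraMap (Polynomial ℚ) (RatFunc ℚ) f / algebraMap (Polynomial ℚ) (RatFunc ℚ) g)


theorem qiP_prime {p : ℕ} (hp : p.Prime) : Prime (qiP p) := by
  have : Fact p.Prime := ⟨hp⟩
  have h : qiP p = Polynomial.cyclotomic p ℚ := by
    rw [Polynomial.cyclotomic_prime]; rfl
  rw [h]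
  exact (Polynomial.cyclotomic.irreducible_rat hp.pos).prime

theorem algebraMap_qiP (N : ℕ) : algebraMap (Polynomial ℚ) (RatFunc ℚ) (qiP N) = qiR N := by
  simp [qiP, qiR, map_sum, map_pow, RatFunc.algebraMap_X]

/-- `[p]`-integral rational functions. -/
def OInt (p : ℕ) (A : RatFunc ℚ) : Prop :=
  ∃ f g : Polynomial ℚ, ¬ (qiP p ∣ g) ∧
    A = algebraMap (Polynomial ℚ) (RatFunc ℚ) f / algebraMap (Polynomial ℚ) (RatFunc ℚ) g

theorem amap_ne {p : ℕ} {g : Polynomial ℚ} (h : ¬ qiP p ∣ g) :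
    algebraMap (Polynomial ℚ) (RatFunc ℚ) g ≠ 0 := by
  intro h0
  apply h
  have : g = 0 := by
    apply IsFractionRing.injective (Polynomial ℚ) (RatFunc ℚ)
    rw [h0, map_zero]
  rw [this]; exact dvd_zero _

theorem OInt.poly {p : ℕ} (hp : p.Prime) (f : Polynomial ℚ) :
    OInt p (algebraMap (Polynomial ℚ) (RatFunc ℚ) f) :=
  ⟨f, 1, fun h => (qiP_prime hp).not_isUnit (isUnit_of_dvd_one h), by simp⟩

theorem OInt.invPoly {p : ℕ} {g : Polynomial ℚ} (h : ¬ qiP p ∣ g) :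
    OInt p (algebraMap (Polynomial ℚ) (RatFunc ℚ) g)⁻¹ :=
  ⟨1, g, h, by simp⟩

theorem OInt.add {p : ℕ} (hp : p.Prime) {A B : RatFunc ℚ} (hA : OInt p A) (hB : OInt p B) :
    OInt p (A + B) := by
  obtain ⟨f, g, hg, rfl⟩ := hA
  obtain ⟨f', g', hg', rfl⟩ := hB
  refine ⟨f * g' + g * f', g * g', fun h => ((qiP_prime hp).dvd_or_dvd h).elim hg hg', ?_⟩
  rw [div_add_div _ _ (amap_ne hg) (amap_ne hg')]
  simp

theorem OInt.mul {p : ℕ} (hp : p.Prime) {A B : RatFunc ℚ} (hA : OInt p A) (hB : OInt p B) :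
    OInt p (A * B) := by
  obtain ⟨f, g, hg, rfl⟩ := hA
  obtain ⟨f', g', hg', rfl⟩ := hB
  refine ⟨f * f', g * g', fun h => ((qiP_prime hp).dvd_or_dvd h).elim hg hg', ?_⟩
  rw [div_mul_div_comm]
  simp

/-- The subring of `[p]`-integral rational functions. -/
def ORing {p : ℕ} (hp : p.Prime) : Subring (RatFunc ℚ) where
  carrier := {A | OInt p A}
  mul_mem' := OInt.mul hp
  add_mem' := OInt.add hp
  one_mem' := by simpa using OInt.poly hp 1
  zero_mem' := by simpa using OInt.poly hp 0
  neg_mem' := by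
    intro A hA
    have := OInt.mul hp (OInt.poly hp (-1)) hA
    simpa using this

theorem congMod_iff {p : ℕ} (hp : p.Prime) (n : ℕ) (A B : RatFunc ℚ) :
    CongMod p n A B ↔ ∃ r ∈ ORing hp, A - B = qiR p ^ n * r := by
  rw [← algebraMap_qiP]
  constructor
  · rintro ⟨f, g, hg, h⟩
    exact ⟨_, ⟨f, g, hg, rfl⟩, h⟩
  · rintro ⟨r, ⟨f, g, hg, rfl⟩, h⟩
    exact ⟨f, g, hg, h⟩

section cong
variable {p : ℕ} (hp : p.Prime) {n : ℕ}

theorem qi_mem (N : ℕ) : qiR N ∈ ORing hp := by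
  rw [← algebraMap_qiP]; exact OInt.poly hp _

theorem X_mem : (RatFunc.X : RatFunc ℚ) ∈ ORing hp := by
  rw [← RatFunc.algebraMap_X]; exact OInt.poly hp _

theorem Xinv_mem : (RatFunc.X : RatFunc ℚ)⁻¹ ∈ ORing hp := by
  rw [← RatFunc.algebraMap_X]
  apply OInt.invPoly
  intro h
  apply (qiP_prime hp).not_isUnit
  apply isUnit_of_dvd_one
  obtain ⟨m, rfl⟩ : ∃ m, p = m + 1 := ⟨p - 1, by have := hp.pos; omega⟩
  have h2 : qiP (m + 1) = 1 + Polynomial.X * ∑ i ∈ Finset.range m, Polynomial.X ^ i := by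
    unfold qiP
    rw [Finset.sum_range_succ', Finset.mul_sum, add_comm]
    simp [pow_succ']
  have h3 := dvd_refl (qiP (m + 1))
  nth_rewrite 2 [h2] at h3
  exact (dvd_add_left (h.mul_right _)).1 h3

theorem qiP_ne_dvd (hp : p.Prime) {y : ℕ} (h1 : 1 ≤ y) (h2 : y < p) : ¬ qiP p ∣ qiP y := by
  have : Fact p.Prime := ⟨hp⟩
  have h : qiP p = Polynomial.cyclotomic p ℚ := by
    rw [Polynomial.cyclotomic_prime]; rfl
  have hd : (qiP p).natDegree = p - 1 := by
    rw [h, Polynomial.natDegree_cyclotomic, Nat.totient_prime hp]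
  have hy : (qiP y).natDegree ≤ y - 1 := by
    unfold qiP
    apply Polynomial.natDegree_sum_le_of_forall_le
    intro i hi
    rw [Polynomial.natDegree_X_pow]
    have := mem_range.1 hi
    omega
  have h0 : qiP y ≠ 0 := by
    intro h0
    have h3 : (qiP y).eval 1 = (y : ℚ) := by simp [qiP, Polynomial.eval_finsetSum]
    rw [h0, Polynomial.eval_zero] at h3
    have : y = 0 := by exact_mod_cast h3.symm
    omega
  intro hdvd
  have := Polynomial.natDegree_le_of_dvd hdvd h0
  omega

theorem qiinv_mem {y : ℕ} (h1 : 1 ≤ y) (h2 : y < p) : (qiR y)⁻¹ ∈ ORing hp := by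
  rw [← algebraMap_qiP]; exact OInt.invPoly (qiP_ne_dvd hp h1 h2)

theorem qiR_ne {y : ℕ} (h1 : 1 ≤ y) : qiR y ≠ 0 := by
  obtain ⟨p, hp1, hp⟩ := Nat.exists_infinite_primes (y + 1)
  rw [← algebraMap_qiP]
  exact amap_ne (qiP_ne_dvd hp h1 (by omega))

/-- Congruence in subring form. -/
def Cg (n : ℕ) (A B : RatFunc ℚ) : Prop := ∃ r ∈ ORing hp, A - B = qiR p ^ n * r

theorem Cg.refl (A : RatFunc ℚ) : Cg hp n A A := ⟨0, zero_mem _, by simp⟩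

variable {hp}

theorem Cg.symm {A B : RatFunc ℚ} (h : Cg hp n A B) : Cg hp n B A := by
  obtain ⟨r, hr, h⟩ := h
  exact ⟨-r, neg_mem hr, by rw [mul_neg, ← h]; ring⟩

theorem Cg.trans {A B C : RatFunc ℚ} (h : Cg hp n A B) (h' : Cg hp n B C) : Cg hp n A C := by
  obtain ⟨r, hr, h⟩ := h
  obtain ⟨r', hr', h'⟩ := h'
  exact ⟨r + r', add_mem hr hr', by rw [mul_add, ← h, ← h']; ring⟩

theorem Cg.add {A B C D : RatFunc ℚ} (h : Cg hp n A B) (h' : Cg hp n C D) :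
    Cg hp n (A + C) (B + D) := by
  obtain ⟨r, hr, h⟩ := h
  obtain ⟨r', hr', h'⟩ := h'
  exact ⟨r + r', add_mem hr hr', by rw [mul_add, ← h, ← h']; ring⟩

theorem Cg.mul_left {A B C : RatFunc ℚ} (hC : C ∈ ORing hp) (h : Cg hp n A B) :
    Cg hp n (C * A) (C * B) := by
  obtain ⟨r, hr, h⟩ := h
  exact ⟨C * r, mul_mem hC hr, by rw [← mul_sub, h]; ring⟩

theorem Cg.mul {A B C D : RatFunc ℚ} (hB : B ∈ ORing hp) (hC : C ∈ ORing hp)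
    (h : Cg hp n A B) (h' : Cg hp n C D) :
    Cg hp n (A * C) (B * D) := by
  have h1 := h.mul_left hC
  rw [mul_comm C A, mul_comm C B] at h1
  exact h1.trans (h'.mul_left hB)

theorem Cg.sum {ι : Type*} (s : Finset ι) {f g : ι → RatFunc ℚ}
    (h : ∀ i ∈ s, Cg hp n (f i) (g i)) : Cg hp n (∑ i ∈ s, f i) (∑ i ∈ s, g i) := by
  classical
  induction s using Finset.induction_on with
  | empty => simpa using Cg.refl hp 0
  | insert a s ha ih =>
    rw [Finset.sum_insert ha, Finset.sum_insert ha]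
    exact (h a (by simp)).add (ih fun i hi => h i (by simp [hi]))

theorem Cg.prod {ι : Type*} (s : Finset ι) {f g : ι → RatFunc ℚ}
    (hf : ∀ i ∈ s, f i ∈ ORing hp) (hg : ∀ i ∈ s, g i ∈ ORing hp)
    (h : ∀ i ∈ s, Cg hp n (f i) (g i)) : Cg hp n (∏ i ∈ s, f i) (∏ i ∈ s, g i) := by
  classical
  induction s using Finset.induction_on with
  | empty => simpa using Cg.refl hp 1
  | insert a s ha ih =>
    rw [Finset.prod_insert ha, Finset.prod_insert ha]
    refine Cg.mul (hg a (by simp)) (prod_mem fun i hi => hf i (by simp [hi])) (h a (by simp))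
      (ih (fun i hi => hf i (by simp [hi])) (fun i hi => hg i (by simp [hi]))
       fun i hi => h i (by simp [hi]))

/-- telescoping of truncated binomial series -/
theorem trunc_step (u : RatFunc ℚ) (k n : ℕ) :
    (1 - u) * ∑ l ∈ range (n + 1), (Nat.choose (k + 1 + l - 1) l : RatFunc ℚ) * u ^ l
      = ∑ l ∈ range (n + 1), (Nat.choose (k + l - 1) l : RatFunc ℚ) * u ^ l
        - (Nat.choose (k + n) n : RatFunc ℚ) * u ^ (n + 1) := by
  induction n with
  | zero => simp
  | succ n ih =>
    rw [sum_range_succ, mul_add, ih, sum_range_succ _ (n + 1)]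
    have h1 : k + 1 + (n + 1) - 1 = (k + n) + 1 := by omega
    have h2 : k + (n + 1) - 1 = k + n := by omega
    have h3 : k + (n + 1) = (k + n) + 1 := by omega
    rw [h1, h2, h3, Nat.choose_succ_succ]
    push_cast
    ring

theorem geom_cg (u : RatFunc ℚ) (s : RatFunc ℚ) (hs : s ∈ ORing hp) (hu : u = qiR p * s)
    (hz : 1 - u ≠ 0) (hzi : (1 - u)⁻¹ ∈ ORing hp) (n k : ℕ) :
    Cg hp (n + 1) (((1 - u)⁻¹) ^ k)
      (∑ l ∈ range (n + 1), (Nat.choose (k + l - 1) l : RatFunc ℚ) * u ^ l) := by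
  induction k with
  | zero =>
    rw [sum_range_succ']
    have : ∑ l ∈ range n, (Nat.choose (0 + (l + 1) - 1) (l + 1) : RatFunc ℚ) * u ^ (l + 1) = 0 := by
      apply sum_eq_zero
      intro l _
      simp
    rw [this]
    simpa using Cg.refl hp 1
  | succ k ih =>
    rw [pow_succ']
    refine (ih.mul_left hzi).trans ?_
    refine ⟨(1 - u)⁻¹ * ((Nat.choose (k + n) n : RatFunc ℚ) * s ^ (n + 1)),
      mul_mem hzi (mul_mem (natCast_mem _ _) (pow_mem hs _)), ?_⟩
    have h := trunc_step u k n
    apply mul_left_cancel₀ hz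
    rw [mul_sub, h, mul_inv_cancel_left₀ hz]
    have h4 : (1 - u) * (qiR p ^ (n + 1) * ((1 - u)⁻¹ * ((Nat.choose (k + n) n : RatFunc ℚ) * s ^ (n + 1))))
      = (Nat.choose (k + n) n : RatFunc ℚ) * (qiR p * s) ^ (n + 1) := by
      rw [mul_pow]
      field_simp
    rw [h4, ← hu]
    ring

end cong

/-- the index set -/
def ASet (star : Bool) (d m : ℕ) : Finset (Fin d → ℕ) :=
  (Fintype.piFinset fun _ => Finset.Icc 1 m).filter
    (fun x => ∀ i j, i < j → if star then x j ≤ x i else x j < x i)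

theorem MHqS_eq (star : Bool) (num : ℕ → ℕ → ℕ) (d : ℕ) (m : ℕ) (k : Fin d → ℕ) :
    MHqS star num m (List.ofFn k) =
      ∑ x ∈ ASet star d m, ∏ j, (RatFunc.X ^ (num (k j) (x j)) / (qiR (x j)) ^ (k j)) := by
  induction d generalizing m with
  | zero =>
    have : ASet star 0 m = {fun i => i.elim0} := by
      ext x
      simp only [ASet, mem_filter, Fintype.mem_piFinset, mem_singleton]
      constructor
      · intro _; exact Subsingleton.elim _ _
      · intro _; exact ⟨fun i => i.elim0, fun i => i.elim0⟩
    rw [this]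
    simp [MHqS]
  | succ d ih =>
    rw [List.ofFn_succ, MHqS]
    simp_rw [ih, mul_sum]
    rw [sum_sigma']
    refine sum_bij' (fun a _ => (Fin.cons a.1 a.2 : Fin (d + 1) → ℕ))
      (fun x _ => ⟨x 0, fun j => x j.succ⟩) ?_ ?_ ?_ ?_ ?_
    · rintro ⟨i, x⟩ h
      simp only [ASet, mem_sigma, mem_filter, Fintype.mem_piFinset, mem_Icc] at h ⊢
      obtain ⟨hi, hx, hr⟩ := h
      refine ⟨?_, ?_⟩
      · refine Fin.cases (by simpa using hi) (fun j => ?_)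
        have := hx j
        simp only [Fin.cons_succ]
        cases star <;> simp at this <;> omega
      · intro a b hab
        induction b using Fin.cases with
        | zero => simp at hab
        | succ b =>
          induction a using Fin.cases with
          | zero =>
            have := hx b
            cases star <;> simp at this ⊢ <;> omega
          | succ a => simpa using hr a b (by simpa using hab)
    · intro x h
      simp only [ASet, mem_sigma, mem_filter, Fintype.mem_piFinset, mem_Icc] at h ⊢
      obtain ⟨hx, hr⟩ := h
      refine ⟨hx 0, fun j => ?_, fun a b hab => hr _ _ (by simpa using hab)⟩
      have h1 := hx j.succ
      have h2 := hr 0 j.succ (Fin.succ_pos j)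
      cases star <;> simp at h2 ⊢ <;> omega
    · rintro ⟨i, x⟩ h
      simp
    · intro x h
      exact Fin.cons_self_tail x
    · rintro ⟨i, x⟩ h
      rw [Fin.prod_univ_succ]
      simp

theorem ASet_rev (star : Bool) (d p : ℕ) (f : (Fin d → ℕ) → RatFunc ℚ) :
    ∑ x ∈ ASet star d (p - 1), f x = ∑ x ∈ ASet star d (p - 1), f (fun j => p - x j.rev) := by
  have key : ∀ x ∈ ASet star d (p - 1), (fun j : Fin d => p - x j.rev) ∈ ASet star d (p - 1) := by
    intro x h
    simp only [ASet, mem_filter, Fintype.mem_piFinset, mem_Icc] at h ⊢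
    obtain ⟨hx, hr⟩ := h
    refine ⟨fun j => by have := hx j.rev; omega, fun a b hab => ?_⟩
    have h1 := hr b.rev a.rev (by simpa using hab)
    have h2 := hx b.rev
    have h3 := hx a.rev
    cases star <;> simp at h1 ⊢ <;> omega
  have inv : ∀ x ∈ ASet star d (p - 1), (fun j : Fin d => p - (p - x j.rev.rev)) = x := by
    intro x h
    simp only [ASet, mem_filter, Fintype.mem_piFinset, mem_Icc] at h
    funext j
    have := h.1 j
    simp only [Fin.rev_rev]
    omega
  refine sum_bij' (fun x _ => fun j => p - x j.rev) (fun x _ => fun j => p - x j.rev) key key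
    inv inv ?_
  intro x h
  have := inv x h
  simp only [this]

theorem qi_reflect {p y : ℕ} (hy : y ≤ p) :
    qiR (p - y) = qiR p - RatFunc.X ^ (p - y) * qiR y := by
  have h : p = (p - y) + y := by omega
  have : qiR p = qiR (p - y) + RatFunc.X ^ (p - y) * qiR y := by
    conv_lhs => rw [h]
    unfold qiR
    rw [sum_range_add, mul_sum]
    simp [pow_add]
  rw [this]; ring

theorem one_cg {p : ℕ} (hp : p.Prime) (n k y : ℕ) (hk : 1 ≤ k) (h1 : 1 ≤ y) (h2 : y < p) :
    Cg hp (n + 1) (RatFunc.X ^ (barNum k (p - y)) / qiR (p - y) ^ k)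
      (((-1 : RatFunc ℚ) * (RatFunc.X ^ p)⁻¹) ^ k * RatFunc.X ^ p *
        ∑ l ∈ range (n + 1), ((RatFunc.X ^ p)⁻¹ * qiR p) ^ l * (Nat.choose (k + l - 1) l : RatFunc ℚ)
          * (RatFunc.X ^ (stdNum (k + l) y) / qiR y ^ (k + l))) := by
  have hX : (RatFunc.X : RatFunc ℚ) ≠ 0 := RatFunc.X_ne_zero
  have hy := qiR_ne h1
  have hpy := qiR_ne (y := p - y) (by omega)
  set s : RatFunc ℚ := (RatFunc.X⁻¹) ^ p * RatFunc.X ^ y * (qiR y)⁻¹ with hs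
  set c : RatFunc ℚ := ((-1 : RatFunc ℚ) * (RatFunc.X ^ p)⁻¹) ^ k * RatFunc.X ^ p *
     (RatFunc.X ^ (stdNum k y) / qiR y ^ k) with hc
  have hXp : (RatFunc.X : RatFunc ℚ) ^ p = RatFunc.X ^ (p - y) * RatFunc.X ^ y := by
    rw [← pow_add]; congr 1; omega
  have hz : 1 - qiR p * s = - (qiR (p - y) * RatFunc.X⁻¹ ^ (p - y) * (qiR y)⁻¹) := by
    rw [qi_reflect h2.le, hs, inv_pow, inv_pow, hXp]
    field_simp
    ring
  have hsm : s ∈ ORing hp :=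
    mul_mem (mul_mem (pow_mem (Xinv_mem hp) _) (pow_mem (X_mem hp) _)) (qiinv_mem hp h1 h2)
  have hz0 : 1 - qiR p * s ≠ 0 := by
    rw [hz]
    exact neg_ne_zero.2 (mul_ne_zero (mul_ne_zero hpy (pow_ne_zero _ (inv_ne_zero hX)))
      (inv_ne_zero hy))
  have hzi : (1 - qiR p * s)⁻¹ = - ((qiR (p - y))⁻¹ * RatFunc.X ^ (p - y) * qiR y) := by
    rw [hz, inv_neg, mul_inv, mul_inv, inv_inv, inv_pow, inv_inv]
  have hzim : (1 - qiR p * s)⁻¹ ∈ ORing hp := by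
    rw [hzi]
    exact neg_mem (mul_mem (mul_mem (qiinv_mem hp (by omega) (by omega)) (pow_mem (X_mem hp) _))
      (qi_mem hp _))
  have hcm : c ∈ ORing hp := by
    rw [hc, div_eq_mul_inv, ← inv_pow, ← inv_pow]
    exact mul_mem (mul_mem (pow_mem (mul_mem (neg_mem (one_mem _)) (pow_mem (Xinv_mem hp) _)) _)
      (pow_mem (X_mem hp) _)) (mul_mem (pow_mem (X_mem hp) _) (pow_mem (qiinv_mem hp h1 h2) _))
  have main := (geom_cg _ s hsm rfl hz0 hzim n k).mul_left hcm
  convert main using 1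
  · rw [hzi, hc]
    obtain ⟨j, rfl⟩ : ∃ j, k = j + 1 := ⟨k - 1, by omega⟩
    have e : (RatFunc.X : RatFunc ℚ) ^ stdNum (j + 1) y = (RatFunc.X ^ y) ^ j := by
      rw [← pow_mul]; simp [stdNum, mul_comm]
    rw [e, hXp, neg_pow (_ * _ * _), neg_one_mul, neg_pow (_⁻¹), barNum]
    have e2 : ((-1 : RatFunc ℚ) ^ (j + 1)) * (-1) ^ (j + 1) = 1 := by
      rw [← mul_pow]; simp
    generalize (-1 : RatFunc ℚ) ^ (j + 1) = ε at *
    have ha : (RatFunc.X : RatFunc ℚ) ^ (p - y) ≠ 0 := pow_ne_zero _ hX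
    have hY : (RatFunc.X : RatFunc ℚ) ^ y ≠ 0 := pow_ne_zero _ hX
    clear * - e2 ha hY hy hpy
    generalize (RatFunc.X : RatFunc ℚ) ^ (p - y) = a at *
    generalize (RatFunc.X : RatFunc ℚ) ^ y = Y at *
    generalize qiR (p - y) = r at *
    generalize qiR y = w at *
    have e3 : ε * (a * Y)⁻¹ ^ (j + 1) * (a * Y) * (Y ^ j / w ^ (j + 1)) *
        (ε * (r⁻¹ * a * w) ^ (j + 1)) = (ε * ε) * ((a * Y)⁻¹ ^ (j + 1) * (a * Y) *
        (Y ^ j / w ^ (j + 1)) * (r⁻¹ * a * w) ^ (j + 1)) := by ring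
    rw [e3, e2]
    simp only [mul_pow, mul_inv, inv_pow]
    field_simp
    ring
  · rw [hc, mul_assoc (_ * _) (_ / _), mul_sum (range (n + 1)) _ (_ / _)]
    congr 1
    apply sum_congr rfl
    intro l _
    obtain ⟨j, rfl⟩ : ∃ j, k = j + 1 := ⟨k - 1, by omega⟩
    have e : (RatFunc.X : RatFunc ℚ) ^ stdNum (j + 1 + l) y
       = RatFunc.X ^ stdNum (j + 1) y * (RatFunc.X ^ y) ^ l := by
      rw [← pow_mul, ← pow_add]; congr 1; simp only [stdNum]
      rw [show j + 1 + l - 1 = j + l by omega, show j + 1 - 1 = j by omega]; ring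
    rw [e, hs, inv_pow, pow_add (qiR y)]
    simp only [mul_pow, inv_pow]
    field_simp

/-- Reversal formula (Theorem 5.2 of the paper):
`H̄•_{p−1}(k; q) ≡ (−q^{−p})^{wt(k)} q^{dp} Σ_{wt(l) < n} (q^{−p}[p])^{wt(l)} b(k;l)
H•_{p−1}(rev(k+l); q) (mod [p]^n)` for both `• = ∅` and `• = ⋆`. -/
theorem stmt1 (p : ℕ) (hp : p.Prime) (n : ℕ) (hn : 1 ≤ n)
    (d : ℕ) (k : Fin d → ℕ) (hk : ∀ i, 1 ≤ k i) (star : Bool) :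
    CongMod p n
      (MHqS star barNum (p - 1) (List.ofFn k))
      (((-1 : RatFunc ℚ) * (RatFunc.X ^ p)⁻¹) ^ (∑ i, k i) * RatFunc.X ^ (d * p) *
        ∑ l ∈ Finset.univ.filter (fun l : Fin d → Fin n => (∑ i, (l i : ℕ)) < n),
          ((RatFunc.X ^ p)⁻¹ * qiR p) ^ (∑ i, (l i : ℕ)) *
            ((∏ j, Nat.choose (k j + (l j : ℕ) - 1) (l j) : ℕ) : RatFunc ℚ) *
            MHqS star stdNum (p - 1) (List.ofFn (fun i => k i + (l i : ℕ))).reverse) := by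
  obtain ⟨n, rfl⟩ : ∃ m, n = m + 1 := ⟨n - 1, by omega⟩
  rw [congMod_iff hp]
  change Cg hp (n + 1) _ _
  rw [MHqS_eq, ASet_rev]
  have hrev : ∀ l : Fin d → Fin (n + 1),
      MHqS star stdNum (p - 1) (List.ofFn (fun i => k i + (l i : ℕ))).reverse =
      ∑ x ∈ ASet star d (p - 1), ∏ j, (RatFunc.X ^ (stdNum (k j + l j) (x j.rev))
        / (qiR (x j.rev)) ^ (k j + l j)) := by
    intro l
    have : (List.ofFn (fun i => k i + (l i : ℕ))).reverse
        = List.ofFn (fun i : Fin d => k i.rev + (l i.rev : ℕ)) := by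
      apply List.ext_getElem (by simp)
      intro i h1 h2
      simp only [List.length_reverse, List.length_ofFn] at h1
      simp only [List.getElem_reverse, List.getElem_ofFn, List.length_ofFn]
      have e : ∀ h, (⟨d - 1 - i, h⟩ : Fin d) = (⟨i, h1⟩ : Fin d).rev := by
        intro h
        ext
        simp only [Fin.val_rev]
        omega
      rw [e]
    rw [this, MHqS_eq]
    apply sum_congr rfl
    intro x _
    rw [← Equiv.prod_comp Fin.revPerm]
    simp
  simp_rw [hrev, mul_sum]
  rw [sum_comm]
  apply Cg.sum
  intro x hx
  simp only [ASet, mem_filter, Fintype.mem_piFinset, mem_Icc] at hx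
  have hb : ∀ j : Fin d, 1 ≤ x j.rev ∧ x j.rev < p := fun j => by
    have := hx.1 j.rev
    omega
  have hXpi : (RatFunc.X ^ p : RatFunc ℚ)⁻¹ ∈ ORing hp := by
    rw [← inv_pow]; exact pow_mem (Xinv_mem hp) _
  have hG : ∀ (K y e : ℕ), 1 ≤ y → y < p →
      ((RatFunc.X : RatFunc ℚ) ^ e / qiR y ^ K) ∈ ORing hp := by
    intro K y e h1 h2
    rw [div_eq_mul_inv, ← inv_pow]
    exact mul_mem (pow_mem (X_mem hp) _) (pow_mem (qiinv_mem hp h1 h2) _)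
  have hc : ∀ K : ℕ, ((-1 : RatFunc ℚ) * (RatFunc.X ^ p)⁻¹) ^ K ∈ ORing hp := fun K =>
    pow_mem (mul_mem (neg_mem (one_mem _)) hXpi) _
  have step1 := Cg.prod (hp := hp) (n := n + 1) (univ : Finset (Fin d)) (fun j _ => ?_)
    (fun j _ => ?_) (fun j _ => one_cg hp n (k j) (x j.rev) (hk j) (hb j).1 (hb j).2)
  rotate_left
  · exact hG _ _ _ (by have := hb j; omega) (by have := hb j; omega)
  · exact mul_mem (mul_mem (hc _) (pow_mem (X_mem hp) _)) (sum_mem fun l _ =>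
      mul_mem (mul_mem (pow_mem (mul_mem hXpi (qi_mem hp _)) _) (natCast_mem _ _))
        (hG _ _ _ (hb j).1 (hb j).2))
  refine step1.trans ?_
  rw [prod_mul_distrib, prod_mul_distrib, prod_pow_eq_pow_sum, prod_const, card_univ,
    Fintype.card_fin, ← pow_mul, mul_comm p d, ← mul_sum]
  refine Cg.mul_left (mul_mem (hc _) (pow_mem (X_mem hp) _)) ?_
  simp_rw [← Fin.sum_univ_eq_sum_range (fun l => ((RatFunc.X ^ p)⁻¹ * qiR p) ^ l *
    (Nat.choose (_ + l - 1) l : RatFunc ℚ)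
          * (RatFunc.X ^ (stdNum (_ + l) _) / qiR _ ^ (_ + l))) (n + 1)]
  rw [prod_univ_sum, Fintype.piFinset_univ, sum_filter]
  apply Cg.sum
  intro l _
  rw [prod_mul_distrib, prod_mul_distrib, prod_pow_eq_pow_sum, Nat.cast_prod]
  split_ifs with hl
  · exact Cg.refl hp _
  · refine ⟨((RatFunc.X ^ p)⁻¹) ^ (∑ i, (l i : ℕ)) * qiR p ^ ((∑ i, (l i : ℕ)) - (n + 1)) *
      (∏ j, (Nat.choose (k j + (l j : ℕ) - 1) (l j) : RatFunc ℚ)) *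
      ∏ j, (RatFunc.X ^ (stdNum (k j + l j) (x j.rev)) / (qiR (x j.rev)) ^ (k j + l j)), ?_, ?_⟩
    · exact mul_mem (mul_mem (mul_mem (pow_mem hXpi _) (pow_mem (qi_mem hp _) _))
        (prod_mem fun j _ => natCast_mem _ _)) (prod_mem fun j _ => hG _ _ _ (hb j).1 (hb j).2)
    · have : qiR p ^ (∑ i, (l i : ℕ)) = qiR p ^ (n + 1) * qiR p ^ ((∑ i, (l i : ℕ)) - (n + 1)) := by
        rw [← pow_add]; congr 1; omega
      rw [mul_pow, this]
      ring
end

section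
/- Let p be a prime, n ≥ 1, and let k = (k_1, …, k_d) be an index of depth d ≥ 1. Let α be the set of distinct cyclic rotations of k (the indices (k_{j+1}, …, k_d, k_1, …, k_j) for 0 ≤ j < d). Then in ℚ(q): Σ_{k' ∈ α} Σ_{s=0}^{k'_1 − 2} H_{p−1}((k'_1 − s, k'_2, …, k'_d, s+1); q) ≡ Σ_{k' ∈ α} H_{p−1}((k'_1 + 1, k'_2, …, k'_d); q) + Σ_{k' ∈ α} Σ_{l=0}^{n−1} (q^{−p}[p])^l · [ H_{p−1}((k'_2, …, k'_d, k'_1, l+1); q) + H_{p−1}((k'_2, …, k'_d, k'_1 + l + 1); q) ] + (1 − q) · Σ_{k' ∈ α} Σ_{l=0}^{n−1} (q^{−p}[p])^l · H_{p−1}((k'_2, …, k'_d, k'_1 + l); q) (mod [p]^n). (For k' with k'_1 = 1 the inner sum over s is empty.) -/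
open Finset

/-- Multiple harmonic q-sum `H_m(k; q)` of the Bradley--Zhao model (strict inequalities). -/
noncomputable def Hq : ℕ → List ℕ → RatFunc ℚ
  | _, [] => 1
  | m, k :: ks => ∑ i ∈ Finset.Icc 1 m,
      (RatFunc.X ^ ((k - 1) * i) / (qiR i) ^ k) * Hq (i - 1) ks

/-- The set of distinct cyclic rotations of an index. -/
def cycOrbit (k : List ℕ) : Finset (List ℕ) :=
  (Finset.range k.length).image (fun j => k.rotate j)

namespace CycSum

abbrev K := RatFunc ℚ

noncomputable def F (k i : ℕ) : K := RatFunc.X ^ ((k - 1) * i) / (qiR i) ^ k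

noncomputable def h (i : ℕ) : K := RatFunc.X ^ i / qiR i

/-- Nested sum with a weight applied to the last (smallest) summation variable. -/
noncomputable def Hl : ℕ → List ℕ → (ℕ → K) → K
  | c, [], g => g c
  | c, k :: ks, g => ∑ i ∈ Finset.Ico 1 c, F k i * Hl i ks g

/-- Nested sum with a weight depending on first and last summation variable. -/
noncomputable def P (p : ℕ) : List ℕ → (ℕ → ℕ → K) → K
  | [], _ => 0
  | k :: ks, g => ∑ i ∈ Finset.Ico 1 p, F k i * Hl i ks (g i)

lemma qiR_eq (N : ℕ) : qiR N = algebraMap (Polynomial ℚ) (RatFunc ℚ) (qiP N) := by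
  simp [qiR, qiP]

lemma qiP_eval_zero (N : ℕ) : (qiP (N + 1)).eval 0 = 1 := by
  simp [qiP, Finset.sum_range_succ', Polynomial.eval_finsetSum]

lemma qiP_ne (N : ℕ) : qiP (N + 1) ≠ 0 := by
  intro h0
  have := qiP_eval_zero N
  rw [h0] at this
  simp at this

lemma qiR_ne {N : ℕ} (hN : 1 ≤ N) : qiR N ≠ 0 := by
  obtain ⟨M, rfl⟩ := Nat.exists_eq_add_of_le' hN
  rw [qiR_eq]
  exact (map_ne_zero_iff _ (RatFunc.algebraMap_injective ℚ)).2 (qiP_ne M)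

lemma qiR_add (a b : ℕ) : qiR (a + b) = qiR a + RatFunc.X ^ a * qiR b := by
  simp [qiR, Finset.sum_range_add, Finset.mul_sum, pow_add]

lemma X_ne : (RatFunc.X : K) ≠ 0 := RatFunc.X_ne_zero

lemma qiR_one_sub (a : ℕ) : qiR a * (1 - RatFunc.X) = 1 - RatFunc.X ^ a := by
  exact geom_sum_mul_neg _ _

lemma inv_eq {a : ℕ} (ha : 1 ≤ a) : (qiR a)⁻¹ = h a + (1 - RatFunc.X) := by
  have := qiR_ne ha
  have h2 := qiR_one_sub a
  unfold h
  field_simp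
  linear_combination -h2

lemma F_succ {k : ℕ} (hk : 1 ≤ k) (i : ℕ) : F (k + 1) i = F k i * h i := by
  obtain ⟨k, rfl⟩ := Nat.exists_eq_add_of_le' hk
  simp only [F, h, Nat.add_sub_cancel]
  rw [div_mul_div_comm, ← pow_add, ← pow_succ]
  ring_nf

lemma F_one (i : ℕ) : F 1 i = (qiR i)⁻¹ := by simp [F]

lemma F_eq (l i : ℕ) : F (l + 1) i = h i ^ l * (qiR i)⁻¹ := by
  induction l with
  | zero => simp [F_one]
  | succ l ih => rw [F_succ (by omega), ih]; ring

lemma F_mul {k : ℕ} (hk : 1 ≤ k) (l : ℕ) {i : ℕ} (hi : 1 ≤ i) :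
    F k i * F (l + 1) i = F (k + l + 1) i + (1 - RatFunc.X) * F (k + l) i := by
  obtain ⟨k, rfl⟩ := Nat.exists_eq_add_of_le' hk
  rw [show k + 1 + l + 1 = (k + l + 1) + 1 by ring, show k + 1 + l = k + l + 1 by ring]
  simp only [F_eq]
  rw [inv_eq hi]
  ring

lemma part_frac (m : ℕ) (b r : ℕ) (hb : 1 ≤ b) (hr : 1 ≤ r) :
    ∑ s ∈ Finset.range m, F (m + 1 - s) (r + b) * F (s + 1) b =
      F (m + 1) b * ((qiR r)⁻¹ - (qiR (r + b))⁻¹) - F (m + 1) (r + b) * h r := by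
  have h1 := qiR_ne hb
  have h2 := qiR_ne hr
  have h3 := qiR_ne (show 1 ≤ r + b by omega)
  have e1 := qiR_add r b
  have e2 := qiR_add b r
  rw [add_comm b r] at e2
  have hX := X_ne
  induction m with
  | zero =>
    simp only [Finset.range_zero, Finset.sum_empty, zero_add, F_one, h]
    field_simp
    linear_combination -e1
  | succ m ih =>
    rw [Finset.sum_range_succ]
    have : ∑ s ∈ Finset.range m, F (m + 1 + 1 - s) (r + b) * F (s + 1) b
        = h (r + b) * ∑ s ∈ Finset.range m, F (m + 1 - s) (r + b) * F (s + 1) b := by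
      rw [Finset.mul_sum]
      refine Finset.sum_congr rfl fun s hs => ?_
      have hs := Finset.mem_range.1 hs
      rw [show m + 1 + 1 - s = (m + 1 - s) + 1 by omega, F_succ (by omega)]
      ring
    rw [this, ih, F_succ (k := m + 1) (by omega) b, F_succ (k := m + 1) (by omega) (r + b),
      show m + 1 + 1 - m = 1 + 1 by omega, F_succ le_rfl, F_one]
    have key : (h b - h (r + b)) * ((qiR r)⁻¹ - (qiR (r + b))⁻¹) = h (r + b) * (qiR (r + b))⁻¹ := by
      have : h b - h (r + b) = h b * qiR r / qiR (r + b) := by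
        unfold h
        rw [pow_add]
        field_simp
        linear_combination e1
      rw [this]
      unfold h
      field_simp
      rw [pow_add]
      linear_combination RatFunc.X ^ b * e1
    linear_combination -F (m + 1) b * key

lemma geom_err (n j r : ℕ) (hj : 1 ≤ j) (hr : 1 ≤ r) :
    h r + ∑ l ∈ Finset.range n, ((RatFunc.X ^ (r + j))⁻¹ * qiR (r + j)) ^ l * F (l + 1) j =
      (qiR (r + j)) ^ n * (((RatFunc.X ^ (r + j))⁻¹ * h j) ^ n * h r) := by
  have h1 := qiR_ne hj
  have h2 := qiR_ne hr
  have e1 := qiR_add r j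
  have hX := X_ne
  set x := (RatFunc.X ^ (r + j))⁻¹ * qiR (r + j) * h j with hx
  have a1 : ∑ l ∈ Finset.range n, ((RatFunc.X ^ (r + j))⁻¹ * qiR (r + j)) ^ l * F (l + 1) j
      = (∑ l ∈ Finset.range n, x ^ l) * (qiR j)⁻¹ := by
    rw [Finset.sum_mul]
    refine Finset.sum_congr rfl fun l _ => ?_
    rw [F_eq, hx]; ring
  have a2 : (1 - x) * h r = -(qiR j)⁻¹ := by
    rw [hx, e1]
    unfold h
    field_simp
    ring
  have a3 := geom_sum_mul_neg x n
  have a4 : (qiR (r + j)) ^ n * (((RatFunc.X ^ (r + j))⁻¹ * h j) ^ n * h r) = x ^ n * h r := by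
    rw [hx]; ring
  rw [a1, a4]
  linear_combination (∑ l ∈ Finset.range n, x ^ l) * a2 - h r * a3

lemma shift (g : ℕ → K) (c p : ℕ) :
    ∑ j ∈ Finset.range (c + 1), g (p + 1 - (j + 1)) = 
      ∑ j ∈ Finset.range c, g (p - (j + 1)) + g p := by
  rw [Finset.sum_range_succ']
  simp only [Nat.add_sub_add_right]
  simp

lemma tele (g : ℕ → K) (c i d : ℕ) (hc : c + 1 ≤ i) :
    ∑ a ∈ Finset.range d, (g (i + 1 + a - (c + 1)) - g (i + 1 + a))
      - ∑ b ∈ Finset.range c, g (i - (b + 1)) =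
    g i - ∑ j ∈ Finset.range (c + 1), g (i + 1 + d - (j + 1)) := by
  induction d with
  | zero => rw [add_zero, shift]; simp
  | succ d ih =>
    rw [Finset.sum_range_succ, ← add_assoc, shift, add_sub_right_comm, ih, Finset.sum_range_succ]
    ring

lemma tele' (c i p : ℕ) (hc : 1 ≤ c) (hi : c ≤ i) (hp : i < p) :
    ∑ a ∈ Finset.Ico (i + 1) p, ((qiR (a - c))⁻¹ - (qiR a)⁻¹)
      - ∑ b ∈ Finset.Ico 1 c, h (i - b) =
    h i - ∑ j ∈ Finset.Ico 1 (c + 1), h (p - j) := by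
  obtain ⟨c, rfl⟩ := Nat.exists_eq_add_of_le' hc
  obtain ⟨d, rfl⟩ := Nat.exists_eq_add_of_le (show i + 1 ≤ p by omega)
  have := tele h c i d hi
  simp only [Finset.sum_Ico_eq_sum_range, Nat.add_sub_cancel, Nat.add_sub_cancel_left,
    add_comm 1] 
  rw [← this]
  congr 1
  refine Finset.sum_congr rfl fun a _ => ?_
  rw [inv_eq (by omega), inv_eq (by omega)]
  ring

/-! ### Nested sums -/

lemma Hq_eq (c : ℕ) (ks : List ℕ) : Hq (c - 1) ks = Hl c ks (fun _ => 1) := by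
  induction ks generalizing c with
  | nil => simp [Hq, Hl]
  | cons k ks ih =>
    simp only [Hq, Hl]
    refine Finset.sum_congr (by ext x; simp; omega) fun i _ => ?_
    rw [ih, F]

lemma Hl_append (c : ℕ) (ks ls : List ℕ) (g : ℕ → K) :
    Hl c (ks ++ ls) g = Hl c ks (fun c' => Hl c' ls g) := by
  induction ks generalizing c with
  | nil => simp [Hl]
  | cons k ks ih => simp [Hl, ih]

lemma Hl_congr {c : ℕ} (ks : List ℕ) {g g' : ℕ → K}
    (H : ∀ j, 1 ≤ j → j ≤ c → g j = g' j) (hc : 1 ≤ c) : Hl c ks g = Hl c ks g' := by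
  induction ks generalizing c with
  | nil => exact H c hc le_rfl
  | cons k ks ih =>
    simp only [Hl]
    refine Finset.sum_congr rfl fun i hi => ?_
    have := Finset.mem_Ico.1 hi
    rw [ih (fun j h1 h2 => H j h1 (by omega)) this.1]

lemma Hl_mul (c : ℕ) (ks : List ℕ) (x : K) (g : ℕ → K) :
    Hl c ks (fun j => x * g j) = x * Hl c ks g := by
  induction ks generalizing c with
  | nil => rfl
  | cons k ks ih =>
    simp only [Hl, ih, Finset.mul_sum]
    exact Finset.sum_congr rfl fun i _ => by ring

lemma Hl_sum {ι : Type} (s : Finset ι) (c : ℕ) (ks : List ℕ) (g : ι → ℕ → K) :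
    Hl c ks (fun j => ∑ a ∈ s, g a j) = ∑ a ∈ s, Hl c ks (g a) := by
  induction ks generalizing c with
  | nil => rfl
  | cons k ks ih =>
    simp only [Hl, ih, Finset.mul_sum]
    exact Finset.sum_comm

lemma Hl_sub (c : ℕ) (ks : List ℕ) (g g' : ℕ → K) :
    Hl c ks (fun j => g j - g' j) = Hl c ks g - Hl c ks g' := by
  induction ks generalizing c with
  | nil => rfl
  | cons k ks ih =>
    simp only [Hl, ih, mul_sub, Finset.sum_sub_distrib]

lemma Hl_add (c : ℕ) (ks : List ℕ) (g g' : ℕ → K) :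
    Hl c ks (fun j => g j + g' j) = Hl c ks g + Hl c ks g' := by
  induction ks generalizing c with
  | nil => rfl
  | cons k ks ih =>
    simp only [Hl, ih, mul_add, Finset.sum_add_distrib]

lemma Hl_snoc (c : ℕ) (ks : List ℕ) (k : ℕ) (g : ℕ → K) :
    Hl c (ks ++ [k]) g = Hl c ks (fun c' => ∑ b ∈ Finset.Ico 1 c', F k b * g b) := by
  rw [Hl_append]; rfl

lemma P_sub (p : ℕ) (ks : List ℕ) (g g' : ℕ → ℕ → K) :
    P p ks (fun i c => g i c - g' i c) = P p ks g - P p ks g' := by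
  cases ks with
  | nil => simp [P]
  | cons k ks => simp only [P, Hl_sub, mul_sub, Finset.sum_sub_distrib]

lemma P_congr (p : ℕ) (ks : List ℕ) {g g' : ℕ → ℕ → K}
    (H : ∀ i c, 1 ≤ c → c ≤ i → i < p → g i c = g' i c) : P p ks g = P p ks g' := by
  cases ks with
  | nil => simp [P]
  | cons k ks =>
    simp only [P]
    refine Finset.sum_congr rfl fun i hi => ?_
    have := Finset.mem_Ico.1 hi
    rw [Hl_congr ks (fun j h1 h2 => H i j h1 h2 this.2) this.1]

lemma P_const (p : ℕ) (ks : List ℕ) (hks : ks ≠ []) (g : ℕ → K) :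
    P p ks (fun _ => g) = Hl p ks g := by
  cases ks with
  | nil => exact absurd rfl hks
  | cons k ks => rfl

noncomputable def φ1 (p : ℕ) (i c : ℕ) : K :=
  ∑ a ∈ Finset.Ico (i + 1) p, ((qiR (a - c))⁻¹ - (qiR a)⁻¹)

noncomputable def φ2 (i c : ℕ) : K := ∑ b ∈ Finset.Ico 1 c, h (i - b)

lemma swap (p : ℕ) (ks : List ℕ) (hks : ks ≠ []) (u : ℕ → ℕ → K) :
    ∑ a ∈ Finset.Ico 1 p, Hl a ks (u a) =
      P p ks (fun i c => ∑ a ∈ Finset.Ico (i + 1) p, u a c) := by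
  cases ks with
  | nil => exact absurd rfl hks
  | cons k ks =>
    simp only [P, Hl, Hl_sum, Finset.mul_sum]
    refine Finset.sum_comm' fun x y => ?_
    simp only [Finset.mem_Ico]
    omega

lemma lhs_one (p k : ℕ) (tl : List ℕ) (hk : 1 ≤ k) :
    ∑ s ∈ Finset.range (k - 1), Hq (p - 1) ((k - s) :: (tl ++ [s + 1])) =
      P p (tl ++ [k]) (φ1 p) - P p (k :: tl) φ2 := by
  obtain ⟨m, rfl⟩ := Nat.exists_eq_add_of_le' hk
  have e1 : P p (tl ++ [m + 1]) (φ1 p) = ∑ a ∈ Finset.Ico 1 p,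
      Hl a (tl ++ [m + 1]) (fun c => (qiR (a - c))⁻¹ - (qiR a)⁻¹) := by
    rw [swap p _ (by simp)]; rfl
  rw [e1]
  simp only [Hq_eq, Hl_snoc, Hl, P, Nat.add_sub_cancel]
  rw [Finset.sum_comm, ← Finset.sum_sub_distrib]
  refine Finset.sum_congr rfl fun a ha => ?_
  have ha := Finset.mem_Ico.1 ha
  simp only [← Hl_mul]
  rw [← Hl_sum, ← Hl_sub]
  refine Hl_congr _ (fun c hc1 hc2 => ?_) ha.1
  simp only [Finset.mul_sum, φ2, mul_one]
  rw [Finset.sum_comm, ← Finset.sum_sub_distrib]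
  refine Finset.sum_congr rfl fun b hb => ?_
  have hb := Finset.mem_Ico.1 hb
  have := part_frac m b (a - b) hb.1 (by omega)
  rw [Nat.sub_add_cancel (by omega)] at this
  exact this

lemma rhs_one (p k : ℕ) (tl : List ℕ) (hk : 1 ≤ k) :
    Hq (p - 1) ((k + 1) :: tl) = P p (k :: tl) (fun i _ => h i) := by
  rw [Hq_eq]
  simp only [P, Hl]
  refine Finset.sum_congr rfl fun i _ => ?_
  have := Hl_mul i tl (h i) (fun _ => 1)
  simp only [mul_one] at this
  rw [this, F_succ hk]; ring

lemma rhs_two (p k l : ℕ) (tl : List ℕ) (hk : 1 ≤ k) (hp : 1 ≤ p) :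
    Hq (p - 1) (tl ++ [k, l + 1]) + Hq (p - 1) (tl ++ [k + l + 1]) +
      (1 - RatFunc.X) * Hq (p - 1) (tl ++ [k + l]) =
    Hl p (tl ++ [k]) (fun c => ∑ j ∈ Finset.Ico 1 (c + 1), F (l + 1) j) := by
  simp only [Hq_eq]
  rw [show tl ++ [k, l + 1] = (tl ++ [k]) ++ [l + 1] by simp]
  simp only [Hl_snoc]
  rw [← Hl_mul, ← Hl_add, ← Hl_add]
  refine Hl_congr _ (fun c _ _ => ?_) hp
  rw [Finset.mul_sum, ← Finset.sum_add_distrib, ← Finset.sum_add_distrib]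
  refine Finset.sum_congr rfl fun b hb => ?_
  have hb := (Finset.mem_Ico.1 hb).1
  rw [Finset.sum_Ico_succ_top hb, mul_add, F_mul hk l hb]
  simp only [mul_one]
  ring

/-! ### Cyclic orbits -/

lemma orbit_ne {k k' : List ℕ} (hne : k ≠ []) (hk : k' ∈ cycOrbit k) : k' ≠ [] := by
  simp only [cycOrbit, Finset.mem_image] at hk
  obtain ⟨j, _, rfl⟩ := hk
  simpa using hne

lemma orbit_mem {k k' : List ℕ} (hk : k' ∈ cycOrbit k) (x : ℕ) (hx : x ∈ k') : x ∈ k := by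
  simp only [cycOrbit, Finset.mem_image] at hk
  obtain ⟨j, _, rfl⟩ := hk
  simpa using hx

lemma orbit_sum (k : List ℕ) (hne : k ≠ []) (G : List ℕ → K) :
    ∑ k' ∈ cycOrbit k, G (k'.rotate 1) = ∑ k' ∈ cycOrbit k, G k' := by
  have inj : Function.Injective (fun l : List ℕ => l.rotate 1) := List.rotate_injective 1
  have himg : (cycOrbit k).image (fun l => l.rotate 1) = cycOrbit k := by
    refine Finset.eq_of_subset_of_card_le ?_ (Finset.card_image_of_injective _ inj).ge
    intro x hx
    simp only [cycOrbit, Finset.mem_image, Finset.mem_range] at hx ⊢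
    obtain ⟨_, ⟨j, hj, rfl⟩, rfl⟩ := hx
    refine ⟨(j + 1) % k.length, Nat.mod_lt _ (List.length_pos_iff.2 hne), ?_⟩
    rw [List.rotate_mod, List.rotate_rotate]
  conv_rhs => rw [← himg]
  rw [Finset.sum_image (fun _ _ _ _ e => inj e)]

/-! ### Integrality -/

def Int' (p : ℕ) (x : K) : Prop := ∃ f g : Polynomial ℚ, ¬ (qiP p ∣ g) ∧
  x = algebraMap (Polynomial ℚ) (RatFunc ℚ) f / algebraMap (Polynomial ℚ) (RatFunc ℚ) g

lemma qiP_prime {p : ℕ} (hp : p.Prime) : Prime (qiP p) := by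
  have := Fact.mk hp
  have : qiP p = Polynomial.cyclotomic p ℚ := by
    rw [Polynomial.cyclotomic_prime]; rfl
  rw [this]
  exact (Polynomial.cyclotomic.irreducible_rat hp.pos).prime

lemma not_dvd_X {p : ℕ} (hp : p.Prime) : ¬ qiP p ∣ Polynomial.X := by
  intro hd
  apply (qiP_prime hp).not_isUnit
  rw [isUnit_iff_dvd_one]
  obtain ⟨m, rfl⟩ := Nat.exists_eq_add_of_le' hp.one_lt.le
  have e : qiP (m + 1) = Polynomial.X * qiP m + 1 := by
    simp [qiP, Finset.sum_range_succ', Finset.mul_sum, pow_succ']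
  have := dvd_sub (dvd_refl (qiP (m + 1))) (hd.mul_right (qiP m))
  rwa [show qiP (m + 1) - Polynomial.X * qiP m = 1 by rw [e]; ring] at this

lemma not_dvd_qiP {p i : ℕ} (h1 : 1 ≤ i) (h2 : i < p) : ¬ qiP p ∣ qiP i := by
  intro hd
  have e : ∀ N, qiP N * (Polynomial.X - 1) = Polynomial.X ^ N - Polynomial.C 1 := fun N => by
    rw [map_one]; exact geom_sum_mul _ _
  have hd2 := mul_dvd_mul_right hd (Polynomial.X - 1)
  rw [e, e] at hd2
  refine Polynomial.not_dvd_of_degree_lt (Polynomial.X_pow_sub_C_ne_zero (by omega) 1) ?_ hd2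
  rw [Polynomial.degree_X_pow_sub_C (by omega), Polynomial.degree_X_pow_sub_C (by omega)]
  exact_mod_cast h2

lemma ne0 {p : ℕ} (hp : p.Prime) {g : Polynomial ℚ} (hg : ¬ qiP p ∣ g) : algebraMap (Polynomial ℚ) (RatFunc ℚ) g ≠ 0 := by
  refine (map_ne_zero_iff _ (RatFunc.algebraMap_injective ℚ)).2 ?_
  rintro rfl
  exact hg (dvd_zero _)

lemma one_int {p : ℕ} (hp : p.Prime) : Int' p 1 := ⟨1, 1, fun hd => (qiP_prime hp).not_isUnit (isUnit_iff_dvd_one.2 hd), by simp⟩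

lemma zero_int {p : ℕ} (hp : p.Prime) : Int' p 0 := ⟨0, 1, fun hd => (qiP_prime hp).not_isUnit (isUnit_iff_dvd_one.2 hd), by simp⟩

lemma add_int {p : ℕ} (hp : p.Prime) {x y : K} (hx : Int' p x) (hy : Int' p y) : Int' p (x + y) := by
  obtain ⟨f, g, hg, rfl⟩ := hx
  obtain ⟨f', g', hg', rfl⟩ := hy
  have h1 := ne0 hp hg
  have h2 := ne0 hp hg'
  refine ⟨f * g' + g * f', g * g', fun hd => ((qiP_prime hp).dvd_or_dvd hd).elim hg hg', ?_⟩
  rw [div_add_div _ _ h1 h2]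
  simp

lemma mul_int {p : ℕ} (hp : p.Prime) {x y : K} (hx : Int' p x) (hy : Int' p y) : Int' p (x * y) := by
  obtain ⟨f, g, hg, rfl⟩ := hx
  obtain ⟨f', g', hg', rfl⟩ := hy
  refine ⟨f * f', g * g', fun hd => ((qiP_prime hp).dvd_or_dvd hd).elim hg hg', ?_⟩
  rw [div_mul_div_comm]
  simp

lemma neg_int {p : ℕ} (hp : p.Prime) {x : K} (hx : Int' p x) : Int' p (-x) := by
  obtain ⟨f, g, hg, rfl⟩ := hx
  exact ⟨-f, g, hg, by simp [neg_div]⟩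

lemma pow_int {p : ℕ} (hp : p.Prime) {x : K} (hx : Int' p x) (m : ℕ) : Int' p (x ^ m) := by
  induction m with
  | zero => simpa using one_int hp
  | succ m ih => rw [pow_succ]; exact mul_int hp ih hx

lemma sum_int {p : ℕ} (hp : p.Prime) {ι : Type} (s : Finset ι) {x : ι → K} (hx : ∀ a ∈ s, Int' p (x a)) :
    Int' p (∑ a ∈ s, x a) :=
  Finset.sum_induction x (Int' p) (fun _ _ => add_int hp) (zero_int hp) hx

lemma X_int {p : ℕ} (hp : p.Prime) : Int' p RatFunc.X :=
  ⟨Polynomial.X, 1, fun hd => (qiP_prime hp).not_isUnit (isUnit_iff_dvd_one.2 hd), by simp⟩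

lemma Xinv_int {p : ℕ} (hp : p.Prime) : Int' p (RatFunc.X)⁻¹ := ⟨1, Polynomial.X, not_dvd_X hp, by simp⟩

lemma qinv_int {p : ℕ} (hp : p.Prime) {i : ℕ} (h1 : 1 ≤ i) (h2 : i < p) : Int' p (qiR i)⁻¹ :=
  ⟨1, qiP i, not_dvd_qiP h1 h2, by simp [qiR_eq]⟩

lemma h_int {p : ℕ} (hp : p.Prime) {i : ℕ} (h1 : 1 ≤ i) (h2 : i < p) : Int' p (h i) := by
  unfold h
  rw [div_eq_mul_inv]
  exact mul_int hp (pow_int hp (X_int hp) _) (qinv_int hp h1 h2)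

lemma F_int {p : ℕ} (hp : p.Prime) (k : ℕ) {i : ℕ} (h1 : 1 ≤ i) (h2 : i < p) : Int' p (F k i) := by
  unfold F
  rw [div_eq_mul_inv, ← inv_pow]
  exact mul_int hp (pow_int hp (X_int hp) _) (pow_int hp (qinv_int hp h1 h2) _)

lemma Hl_int {p : ℕ} (hp : p.Prime) (ks : List ℕ) (hks : ks ≠ []) {g : ℕ → K} (hg : ∀ c, 1 ≤ c → c < p → Int' p (g c)) :
    Int' p (Hl p ks g) := by
  have aux : ∀ (ks : List ℕ) c, 1 ≤ c → c < p → Int' p (Hl c ks g) := by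
    intro ks
    induction ks with
    | nil => exact hg
    | cons k ks ih =>
      intro c h1 h2
      refine sum_int hp _ fun i hi => ?_
      have := Finset.mem_Ico.1 hi
      exact mul_int hp (F_int hp k this.1 (by omega)) (ih i this.1 (by omega))
  cases ks with
  | nil => exact absurd rfl hks
  | cons k ks =>
    refine sum_int hp _ fun i hi => ?_
    have := Finset.mem_Ico.1 hi
    exact mul_int hp (F_int hp k this.1 this.2) (aux ks i this.1 this.2)

noncomputable def err (p n j : ℕ) : K := -(((RatFunc.X ^ p)⁻¹ * h j) ^ n * h (p - j))

lemma diff_eq (p n : ℕ) (hp : p.Prime) (k : List ℕ) (hk : ∀ x ∈ k, 1 ≤ x) (hne : k ≠ []) :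
    (∑ k' ∈ cycOrbit k, ∑ s ∈ Finset.range (k'.headI - 1),
        Hq (p - 1) ((k'.headI - s) :: (k'.tail ++ [s + 1]))) -
      ((∑ k' ∈ cycOrbit k, Hq (p - 1) ((k'.headI + 1) :: k'.tail)) +
        (∑ k' ∈ cycOrbit k, ∑ l ∈ Finset.range n, ((RatFunc.X ^ p)⁻¹ * qiR p) ^ l *
          (Hq (p - 1) (k'.tail ++ [k'.headI, l + 1]) +
            Hq (p - 1) (k'.tail ++ [k'.headI + l + 1]))) +
        (1 - RatFunc.X) *
          ∑ k' ∈ cycOrbit k, ∑ l ∈ Finset.range n, ((RatFunc.X ^ p)⁻¹ * qiR p) ^ l *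
            Hq (p - 1) (k'.tail ++ [k'.headI + l])) =
    qiR p ^ n * ∑ k' ∈ cycOrbit k, Hl p k' (fun c => ∑ j ∈ Finset.Ico 1 (c + 1), err p n j) := by
  set w := (RatFunc.X ^ p)⁻¹ * qiR p with hw
  have form : ∀ k' ∈ cycOrbit k, ∃ a tl, k' = a :: tl ∧ 1 ≤ a := by
    intro k' hk'
    cases k' with
    | nil => exact absurd rfl (orbit_ne hne hk')
    | cons a tl => exact ⟨a, tl, rfl, hk a (orbit_mem hk' a (by simp))⟩
  have L1 : (∑ k' ∈ cycOrbit k, ∑ s ∈ Finset.range (k'.headI - 1),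
        Hq (p - 1) ((k'.headI - s) :: (k'.tail ++ [s + 1]))) =
      ∑ k' ∈ cycOrbit k, P p k' (φ1 p) - ∑ k' ∈ cycOrbit k, P p k' φ2 := by
    rw [← orbit_sum k hne (fun k' => P p k' (φ1 p)), ← Finset.sum_sub_distrib]
    refine Finset.sum_congr rfl fun k' hk' => ?_
    obtain ⟨a, tl, rfl, ha⟩ := form k' hk'
    simpa using lhs_one p a tl ha
  have L2 : (∑ k' ∈ cycOrbit k, Hq (p - 1) ((k'.headI + 1) :: k'.tail)) =
      ∑ k' ∈ cycOrbit k, P p k' (fun i _ => h i) := by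
    refine Finset.sum_congr rfl fun k' hk' => ?_
    obtain ⟨a, tl, rfl, ha⟩ := form k' hk'
    exact rhs_one p a tl ha
  have L3 : (∑ k' ∈ cycOrbit k, ∑ l ∈ Finset.range n, w ^ l *
          (Hq (p - 1) (k'.tail ++ [k'.headI, l + 1]) +
            Hq (p - 1) (k'.tail ++ [k'.headI + l + 1]))) +
        (1 - RatFunc.X) *
          ∑ k' ∈ cycOrbit k, ∑ l ∈ Finset.range n, w ^ l *
            Hq (p - 1) (k'.tail ++ [k'.headI + l]) =
      ∑ k' ∈ cycOrbit k, P p k' (fun _ c => ∑ j ∈ Finset.Ico 1 (c + 1),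
        ∑ l ∈ Finset.range n, w ^ l * F (l + 1) j) := by
    rw [← orbit_sum k hne (fun k' => P p k' _), Finset.mul_sum, ← Finset.sum_add_distrib]
    refine Finset.sum_congr rfl fun k' hk' => ?_
    obtain ⟨a, tl, rfl, ha⟩ := form k' hk'
    rw [Finset.mul_sum, ← Finset.sum_add_distrib]
    simp only [List.rotate_cons_succ, List.rotate_zero, List.headI, List.tail]
    rw [P_const _ _ (by simp)]
    simp_rw [Finset.sum_comm (t := Finset.range n)]
    rw [Hl_sum]
    refine Finset.sum_congr rfl fun l _ => ?_
    simp_rw [← Finset.mul_sum]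
    rw [Hl_mul, ← rhs_two p a l tl ha hp.one_lt.le]
    ring
  rw [add_assoc, L3, L1, L2, Finset.mul_sum, ← Finset.sum_sub_distrib, ← Finset.sum_add_distrib,
    ← Finset.sum_sub_distrib]
  refine Finset.sum_congr rfl fun k' hk' => ?_
  rw [← Hl_mul, ← P_const _ _ (orbit_ne hne hk'), ← P_sub, ← sub_sub, ← P_sub, ← P_sub]
  refine P_congr _ _ fun i c h1 h2 h3 => ?_
  have := tele' c i p h1 h2 h3
  rw [φ1, φ2, this, sub_sub_cancel_left, ← Finset.sum_neg_distrib, ← Finset.sum_sub_distrib,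
    Finset.mul_sum]
  refine Finset.sum_congr rfl fun j hj => ?_
  have hj := Finset.mem_Ico.1 hj
  have := geom_err n j (p - j) hj.1 (by omega)
  rw [Nat.sub_add_cancel (by omega)] at this
  rw [hw, err]
  linear_combination -this

end CycSum

/-- Cyclic sum formula (Theorem 5.9, eq. (5.3) of the paper), non-star version, mod `[p]^n`. -/
theorem stmt6 (p : ℕ) (hp : p.Prime) (n : ℕ) (hn : 1 ≤ n)
    (k : List ℕ) (hk : ∀ x ∈ k, 1 ≤ x) (hne : k ≠ []) :
    CongMod p n
      (∑ k' ∈ cycOrbit k, ∑ s ∈ Finset.range (k'.headI - 1),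
        Hq (p - 1) ((k'.headI - s) :: (k'.tail ++ [s + 1])))
      ((∑ k' ∈ cycOrbit k, Hq (p - 1) ((k'.headI + 1) :: k'.tail)) +
        (∑ k' ∈ cycOrbit k, ∑ l ∈ Finset.range n, ((RatFunc.X ^ p)⁻¹ * qiR p) ^ l *
          (Hq (p - 1) (k'.tail ++ [k'.headI, l + 1]) +
            Hq (p - 1) (k'.tail ++ [k'.headI + l + 1]))) +
        (1 - RatFunc.X) *
          ∑ k' ∈ cycOrbit k, ∑ l ∈ Finset.range n, ((RatFunc.X ^ p)⁻¹ * qiR p) ^ l *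
            Hq (p - 1) (k'.tail ++ [k'.headI + l])) := by
  obtain ⟨f, g, hg, e⟩ := CycSum.sum_int hp (cycOrbit k)
    (x := fun k' => CycSum.Hl p k' (fun c => ∑ j ∈ Finset.Ico 1 (c + 1), CycSum.err p n j))
    (fun k' hk' => CycSum.Hl_int hp k' (CycSum.orbit_ne hne hk') fun c _ h2 =>
      CycSum.sum_int hp _ fun j hj => by
        have hj := Finset.mem_Ico.1 hj
        refine CycSum.neg_int hp (CycSum.mul_int hp (CycSum.pow_int hp (CycSum.mul_int hp ?_
          (CycSum.h_int hp hj.1 (by omega))) n) (CycSum.h_int hp (by omega) (by omega)))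
        rw [← inv_pow]
        exact CycSum.pow_int hp (CycSum.Xinv_int hp) p)
  refine ⟨f, g, hg, ?_⟩
  rw [← e, ← CycSum.qiR_eq]
  exact CycSum.diff_eq p n hp k hk hne
end

section
/- For every prime p, the following identity holds in the field ℚ(q) of rational functions: H_{p−1}((1); q) − ((p−1)/2)·(1 − q) = −(1/2) · [p] · Σ_{m=1}^{p−1} q^m / ( [m] · ([m] − [p]) ). -/
open Finset

/-- `H_{p−1}((1); q) = Σ_{m=1}^{p−1} 1/[m]`. -/
noncomputable def H1 (p : ℕ) : RatFunc ℚ := ∑ m ∈ Finset.Icc 1 (p - 1), 1 / qiR m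

lemma qiR_ne_zero (m : ℕ) (hm : 1 ≤ m) : qiR m ≠ 0 := by
  have h : qiR m = algebraMap (Polynomial ℚ) (RatFunc ℚ)
      (∑ i ∈ Finset.range m, Polynomial.X ^ i) := by
    simp [qiR, map_sum, map_pow, RatFunc.algebraMap_X]
  rw [h]
  intro h0
  have h1 := RatFunc.algebraMap_injective ℚ (h0.trans (map_zero _).symm)
  have h2 := congrArg (Polynomial.eval 1) h1
  simp [Polynomial.eval_finset_sum] at h2
  omega

lemma qiR_add (m k : ℕ) : qiR (m + k) = qiR m + RatFunc.X ^ m * qiR k := by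
  simp only [qiR, Finset.sum_range_add, Finset.mul_sum, pow_add, Finset.sum_range]
  simp [Fin.sum_univ_add, pow_add]

lemma qiR_geom (m : ℕ) : (RatFunc.X : RatFunc ℚ) ^ m = 1 - (1 - RatFunc.X) * qiR m := by
  have := geom_sum_mul (RatFunc.X : RatFunc ℚ) m
  unfold qiR
  linear_combination -this

/-- The identity of Shi--Pan used in Proposition 4.7 of the paper:
`H_{p−1}((1); q) − ((p−1)/2)(1−q) = −(1/2)[p] Σ_{m=1}^{p−1} q^m/([m]([m]−[p]))` in `ℚ(q)`. -/
theorem stmt10 (p : ℕ) (hp : p.Prime) :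
    H1 p - (((p : RatFunc ℚ) - 1) / 2) * (1 - RatFunc.X) =
      -(1 / 2) * qiR p *
        ∑ m ∈ Finset.Icc 1 (p - 1), RatFunc.X ^ m / (qiR m * (qiR m - qiR p)) := by
  have hp1 := hp.one_le
  have hrefl : ∑ m ∈ Finset.Icc 1 (p - 1), 1 / qiR (p - m) = H1 p := by
    unfold H1
    refine Finset.sum_bij' (fun m _ => p - m) (fun m _ => p - m) ?_ ?_ ?_ ?_ ?_
    · intro m hm; simp only [Finset.mem_Icc] at *; omega
    · intro m hm; simp only [Finset.mem_Icc] at *; omega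
    · intro m hm; simp only [Finset.mem_Icc] at *; omega
    · intro m hm; simp only [Finset.mem_Icc] at *; omega
    · intro m hm; rfl
  have key : ∀ m ∈ Finset.Icc 1 (p - 1),
      -(1 / 2) * qiR p * (RatFunc.X ^ m / (qiR m * (qiR m - qiR p))) =
        (1 / 2) * (1 / qiR (p - m)) + (1 / 2) * (1 / qiR m) - (1 / 2) * (1 - RatFunc.X) := by
    intro m hm
    rw [Finset.mem_Icc] at hm
    have ha := qiR_ne_zero m hm.1
    have hb := qiR_ne_zero (p - m) (by omega)
    have hx : (RatFunc.X : RatFunc ℚ) ^ m ≠ 0 := pow_ne_zero _ RatFunc.X_ne_zero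
    have hadd := qiR_add m (p - m)
    rw [show m + (p - m) = p by omega] at hadd
    have hg := qiR_geom m
    rw [hadd]
    generalize qiR m = a at *
    generalize qiR (p - m) = b at *
    generalize (RatFunc.X : RatFunc ℚ) ^ m = x at *
    have e : x / (a * (a - (a + x * b))) = -(1 / (a * b)) := by
      rw [show a * (a - (a + x * b)) = -(x * (a * b)) by ring]
      field_simp
    rw [e]
    field_simp
    rw [hg]
    ring
  rw [Finset.mul_sum, Finset.sum_congr rfl key, Finset.sum_sub_distrib, Finset.sum_add_distrib,
    ← Finset.mul_sum, ← Finset.mul_sum, hrefl]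
  have : ∑ m ∈ Finset.Icc 1 (p - 1), 1 / qiR m = H1 p := rfl
  rw [this]
  simp only [Finset.sum_const, Nat.card_Icc, nsmul_eq_mul]
  rw [show p - 1 + 1 - 1 = p - 1 by omega, Nat.cast_sub hp1]
  push_cast
  have h2 : (1 / 2 : RatFunc ℚ) + 1 / 2 = 1 := add_halves 1
  linear_combination (-H1 p) * h2
end

section
/- Let l ≥ 0 and k, m ≥ 1 be integers. In the ring ℚ[[X]] of formal power series, let u = 1 − X^m (a unit) and let θ be the operator θ(F) = X·F′, where F′ is the formal derivative. Then θ^l ( X^{(k−1)m} · u^{−k} ) = m^l · Σ_{s=0}^{l} s! · ( Σ_{a=s}^{l} binom(l, a) · S(a, s) · (k−1)^{l−a} ) · binom(s+k−1, s) · X^{(k+s−1)m} · u^{−(k+s)}, where S(a, s) denotes the Stirling number of the second kind. -/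
open Finset

/-- Stirling numbers of the second kind: `S(0,0)=1`, `S(j,0)=S(0,j)=0` for `j ≥ 1`,
and `S(j+1,n) = S(j,n−1) + n·S(j,n)`. -/
def stirling2 : ℕ → ℕ → ℕ
  | 0, 0 => 1
  | 0, _ + 1 => 0
  | _ + 1, 0 => 0
  | j + 1, n + 1 => stirling2 j n + (n + 1) * stirling2 j (n + 1)

/-- The theta operator `θ(F) = X·F′` on `ℚ[[X]]`. -/
noncomputable def theta (F : PowerSeries ℚ) : PowerSeries ℚ :=
  PowerSeries.X * F.derivativeFun

theorem theta_zero' : theta 0 = 0 := by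
  change PowerSeries.X * (PowerSeries.derivative ℚ) 0 = 0
  simp

theorem theta_add' (F G : PowerSeries ℚ) : theta (F + G) = theta F + theta G := by
  simp [theta, PowerSeries.derivativeFun_add, mul_add]

theorem theta_C_mul (c : ℚ) (F : PowerSeries ℚ) :
    theta (PowerSeries.C c * F) = PowerSeries.C c * theta F := by
  have := (PowerSeries.derivative ℚ).map_smul c F
  rw [PowerSeries.smul_eq_C_mul, PowerSeries.smul_eq_C_mul] at this
  change PowerSeries.X * (PowerSeries.derivative ℚ) _ =
    PowerSeries.C c * (PowerSeries.X * (PowerSeries.derivative ℚ) F)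
  rw [this]; ring

theorem theta_sum (n : ℕ) (f : ℕ → PowerSeries ℚ) :
    theta (∑ s ∈ Finset.range n, f s) = ∑ s ∈ Finset.range n, theta (f s) := by
  induction n with
  | zero => simp [theta_zero']
  | succ n ih => rw [Finset.sum_range_succ, theta_add', ih, Finset.sum_range_succ]

/-- The basic series `X^{jm} u^{-(j+1)}`. -/
noncomputable def baseF (m j : ℕ) : PowerSeries ℚ :=
  PowerSeries.X ^ (j * m) * ((1 - PowerSeries.X ^ m : PowerSeries ℚ)⁻¹) ^ (j + 1)

theorem theta_baseF (m j : ℕ) (hm : 1 ≤ m) :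
    theta (baseF m j) = PowerSeries.C (m : ℚ) *
      (PowerSeries.C (j : ℚ) * baseF m j + PowerSeries.C ((j : ℚ) + 1) * baseF m (j + 1)) := by
  obtain ⟨n, rfl⟩ : ∃ n, m = n + 1 := ⟨m - 1, by omega⟩
  have hu : (1 - PowerSeries.X ^ (n + 1) : PowerSeries ℚ) *
      (1 - PowerSeries.X ^ (n + 1) : PowerSeries ℚ)⁻¹ = 1 := by
    apply PowerSeries.mul_inv_cancel
    simp
  change PowerSeries.X * (PowerSeries.derivative ℚ) _ = _
  unfold baseF
  rw [Derivation.leibniz, Derivation.leibniz_pow, Derivation.leibniz_pow,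
    PowerSeries.derivative_inv']
  simp only [map_sub, Derivation.leibniz_pow, PowerSeries.derivative_X, smul_eq_mul,
    nsmul_eq_mul, Derivation.map_one_eq_zero, map_natCast, map_add, map_one]
  generalize (1 - PowerSeries.X ^ (n + 1) : PowerSeries ℚ)⁻¹ = v at *
  rcases j with _ | j
  · simp
    ring
  · have e1 : (j + 1) * (n + 1) - 1 = j * (n + 1) + n := by
      rw [add_mul]; omega
    simp only [e1, Nat.add_sub_cancel]
    push_cast
    ring

/-- The inner sum. -/
def innerW (r l s : ℕ) : ℚ :=
  ∑ ij ∈ Finset.HasAntidiagonal.antidiagonal l, (l.choose ij.1 : ℚ) * ((stirling2 ij.1 s : ℚ) * (r : ℚ) ^ ij.2)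

theorem innerW_succ (r l s : ℕ) :
    innerW r (l + 1) (s + 1) = innerW r l s + ((r : ℚ) + s + 1) * innerW r l (s + 1) := by
  unfold innerW
  rw [Finset.sum_antidiagonal_choose_succ_mul
    (fun i j => (stirling2 i (s + 1) : ℚ) * (r : ℚ) ^ j), Finset.mul_sum,
    ← Finset.sum_add_distrib, ← Finset.sum_add_distrib]
  refine Finset.sum_congr rfl fun ij hij => ?_
  rw [Finset.HasAntidiagonal.mem_antidiagonal] at hij
  have : l.choose ij.2 = l.choose ij.1 := by
    rw [← Nat.choose_symm_of_eq_add hij.symm]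
  simp only [this, stirling2]
  push_cast
  ring

theorem innerW_succ_zero (r l : ℕ) : innerW r (l + 1) 0 = r * innerW r l 0 := by
  unfold innerW
  rw [Finset.sum_antidiagonal_choose_succ_mul
    (fun i j => (stirling2 i 0 : ℚ) * (r : ℚ) ^ j), Finset.mul_sum,
    ← Finset.sum_add_distrib]
  refine Finset.sum_congr rfl fun ij hij => ?_
  simp only [stirling2]
  push_cast
  ring

theorem stirling2_lt : ∀ (a s : ℕ), a < s → stirling2 a s = 0
  | _, 0, h => by omega
  | 0, s + 1, _ => by simp [stirling2]
  | a + 1, s + 1, h => by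
    simp [stirling2, stirling2_lt a s (by omega), stirling2_lt a (s + 1) (by omega)]

theorem innerW_lt (r l s : ℕ) (h : l < s) : innerW r l s = 0 := by
  refine Finset.sum_eq_zero fun ij hij => ?_
  rw [Finset.HasAntidiagonal.mem_antidiagonal] at hij
  simp [stirling2_lt ij.1 s (by omega)]

theorem innerW_eq (r l s : ℕ) :
    ∑ a ∈ Finset.Icc s l, (l.choose a : ℚ) * (stirling2 a s : ℚ) * (r : ℚ) ^ (l - a)
      = innerW r l s := by
  unfold innerW
  rw [Finset.Nat.sum_antidiagonal_eq_sum_range_succ_mk]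
  simp only [mul_assoc]
  refine Finset.sum_subset (fun a ha => ?_) fun a ha hn => ?_
  · simp at *; omega
  · simp at ha hn
    rw [stirling2_lt a s (by by_contra h; have := hn (by omega); omega)]
    simp

/-- The full coefficient. -/
def coefW (r l s : ℕ) : ℚ := (s.factorial : ℚ) * innerW r l s * ((s + r).choose s : ℚ)

theorem coefW_zero (r l : ℕ) : coefW r (l + 1) 0 = r * coefW r l 0 := by
  simp [coefW, innerW_succ_zero]

theorem coefW_lt (r l s : ℕ) (h : l < s) : coefW r l s = 0 := by
  simp [coefW, innerW_lt r l s h]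

theorem coefW_succ (r l s : ℕ) : coefW r (l + 1) (s + 1) =
    ((r + s + 1 : ℕ) : ℚ) * coefW r l (s + 1) + ((r + s : ℕ) + 1 : ℚ) * coefW r l s := by
  have h : ((s + 1 + r).choose (s + 1) : ℚ) * (s + 1) = (s + r + 1) * ((s + r).choose s : ℚ) := by
    have := Nat.add_one_mul_choose_eq (s + r) s
    rw [show s + 1 + r = s + r + 1 by ring]
    exact_mod_cast this.symm
  simp only [coefW, innerW_succ, Nat.factorial_succ]
  push_cast
  linear_combination (s.factorial : ℚ) * innerW r l s * h

theorem theta_iter (l r m : ℕ) (hm : 1 ≤ m) :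
    theta^[l] (baseF m r) = PowerSeries.C ((m : ℚ) ^ l) *
      ∑ s ∈ Finset.range (l + 1), PowerSeries.C (coefW r l s) * baseF m (r + s) := by
  induction l with
  | zero => simp [coefW, innerW, stirling2]
  | succ l ih =>
    rw [Function.iterate_succ_apply', ih, theta_C_mul, theta_sum]
    simp only [theta_C_mul, theta_baseF _ _ hm]
    rw [Finset.sum_range_succ' _ (l + 1), coefW_zero]
    simp only [coefW_succ, map_add, map_mul, add_mul, Finset.sum_add_distrib]
    have h := Finset.sum_range_succ' (fun s => PowerSeries.C ((r + s : ℕ) : ℚ) *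
      PowerSeries.C (coefW r l s) * baseF m (r + s)) (l + 1)
    rw [Finset.sum_range_succ, coefW_lt r l (l + 1) (by omega)] at h
    simp only [map_zero, mul_zero, zero_mul, add_zero] at h
    rw [add_right_comm]
    simp only [← add_assoc, Nat.add_zero] at h ⊢
    rw [← h, pow_succ, map_mul, mul_assoc,
      ← Finset.sum_add_distrib, ← Finset.sum_add_distrib]
    rw [Finset.mul_sum _ _ (PowerSeries.C (m : ℚ))]
    congr 1
    refine Finset.sum_congr rfl fun s _ => ?_
    ring

/-- Lemma A.4 of the paper:
`θ^l (X^{(k−1)m} u^{−k}) = m^l Σ_{s=0}^{l} T_{s,l}(k) C(s+k−1, s) X^{(k+s−1)m} u^{−(k+s)}`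
in `ℚ[[X]]`, where `u = 1 − X^m` and
`T_{s,l}(k) = (s!/l!) Σ_{a=s}^{l} C(l,a) S(a,s) (k−1)^{l−a}` (here written as
`s! Σ_{a=s}^{l} C(l,a) S(a,s) (k−1)^{l−a}` after clearing `l!` into the binomials). -/
theorem stmt12 (l k m : ℕ) (hk : 1 ≤ k) (hm : 1 ≤ m) :
    theta^[l] (PowerSeries.X ^ ((k - 1) * m) *
        ((1 - PowerSeries.X ^ m : PowerSeries ℚ)⁻¹) ^ k) =
      ((m : PowerSeries ℚ)) ^ l *
        ∑ s ∈ Finset.range (l + 1),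
          PowerSeries.C ((s.factorial : ℚ) *
              (∑ a ∈ Finset.Icc s l,
                (l.choose a : ℚ) * (stirling2 a s : ℚ) * ((k - 1 : ℕ) : ℚ) ^ (l - a)) *
              ((s + k - 1).choose s : ℚ)) *
            PowerSeries.X ^ ((k + s - 1) * m) *
            ((1 - PowerSeries.X ^ m : PowerSeries ℚ)⁻¹) ^ (k + s) := by
  obtain ⟨r, rfl⟩ : ∃ r, k = r + 1 := ⟨k - 1, by omega⟩
  have h := theta_iter l r m hm
  simp only [Nat.add_sub_cancel, innerW_eq]
  unfold baseF at h
  rw [h, map_pow, map_natCast]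
  congr 1
  refine Finset.sum_congr rfl fun s _ => ?_
  rw [show r + 1 + s - 1 = r + s by omega, show s + (r + 1) - 1 = s + r by omega,
    show r + 1 + s = r + s + 1 by omega, mul_assoc]
  rfl
end

section
/- Let l ≥ j ≥ 0 be integers. For a positive integer m, let S_{l,j}(m) = (1/j!) · g_m^{(j)}(0), where g_m : ℂ → ℂ is the function g_m(y) = (e^{2πi/m} · e^{y/m} − 1)^l and g_m^{(j)}(0) denotes its j-th (iterated complex) derivative at y = 0. Then there exists a constant C > 0 such that for all integers m ≥ 1: | m^l · S_{l,j}(m) − binom(l, j) · (2πi)^{l−j} | ≤ C/m. -/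
open Finset

lemma aux_pow (B : ℝ) (hB : 0 ≤ B) (l : ℕ) (u v : ℂ) (hu : ‖u‖ ≤ B) (hv : ‖v‖ ≤ B) :
    ‖u ^ l - v ^ l‖ ≤ l * B ^ (l - 1) * ‖u - v‖ := by
  induction l with
  | zero => simp
  | succ n ih =>
    have e : u ^ (n + 1) - v ^ (n + 1) = u * (u ^ n - v ^ n) + (u - v) * v ^ n := by ring
    have h1 : ‖u * (u ^ n - v ^ n)‖ ≤ B * (n * B ^ (n - 1) * ‖u - v‖) := by
      rw [norm_mul]
      gcongr
    have h2 : ‖(u - v) * v ^ n‖ ≤ ‖u - v‖ * B ^ n := by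
      rw [norm_mul, norm_pow]
      gcongr
    have h3 : B * (n * B ^ (n - 1) * ‖u - v‖) = n * B ^ n * ‖u - v‖ := by
      rcases n with _ | k
      · simp
      · simp only [Nat.add_sub_cancel]; ring
    rw [e]
    refine (norm_add_le _ _).trans ((add_le_add h1 h2).trans (le_of_eq ?_))
    rw [h3]
    push_cast
    ring

lemma aux_exp (R : ℝ) (m : ℕ) (hm : 1 ≤ m) (z : ℂ) (hz : ‖z‖ ≤ R) :
    ‖(m : ℂ) * (Complex.exp (z / m) - 1) - z‖ ≤ R ^ 2 * Real.exp R / m := by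
  have hm0 : (0 : ℝ) < m := by exact_mod_cast hm
  have hm1 : (1 : ℝ) ≤ m := by exact_mod_cast hm
  have hmc : (m : ℂ) ≠ 0 := by exact_mod_cast hm0.ne'
  have h := Complex.norm_exp_sub_sum_le_norm_mul_exp (z / m) 2
  have hn : ‖z / m‖ = ‖z‖ / m := by simp
  have e : (m : ℂ) * (Complex.exp (z / m) - 1) - z
      = m * (Complex.exp (z / m) - ∑ k ∈ range 2, (z / m) ^ k / k.factorial) := by
    simp [Finset.sum_range_succ]
    field_simp
    ring
  rw [e, norm_mul, Complex.norm_natCast]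
  rw [hn] at h
  have hR : 0 ≤ R := (norm_nonneg z).trans hz
  have h2 : ‖z‖ / m ≤ R := (div_le_self (norm_nonneg z) hm1).trans hz
  calc _ ≤ (m : ℝ) * ((‖z‖ / m) ^ 2 * Real.exp (‖z‖ / m)) := by gcongr
    _ ≤ (m : ℝ) * ((R / m) ^ 2 * Real.exp R) := by gcongr
    _ = _ := by field_simp

/-- Lemma A.3 of the paper:  with
`S_{l,j}(m) = (1/j!) (d/dy)^j (e^{2πi/m} e^{y/m} − 1)^l |_{y=0}`, one has
`m^l S_{l,j}(m) = C(l,j) (2πi)^{l−j} (1 + O(1/m))`, i.e. there is a constant `C > 0` with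
`|m^l S_{l,j}(m) − C(l,j)(2πi)^{l−j}| ≤ C/m` for all `m ≥ 1`. -/
theorem stmt13 (l j : ℕ) (hj : j ≤ l) :
    ∃ C : ℝ, 0 < C ∧ ∀ m : ℕ, 1 ≤ m →
      norm
        ((m : ℂ) ^ l *
            ((1 / (j.factorial : ℂ)) *
              iteratedDeriv j
                (fun y : ℂ =>
                  (Complex.exp (2 * Real.pi * Complex.I / m) * Complex.exp (y / m) - 1) ^ l) 0) -
          (l.choose j : ℂ) * (2 * Real.pi * Complex.I) ^ (l - j)) ≤ C / m := by
  set a : ℂ := 2 * Real.pi * Complex.I with ha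
  set R : ℝ := ‖a‖ + 1 with hR
  have hR0 : 0 < R := by positivity
  set K : ℝ := R ^ 2 * Real.exp R with hK
  have hK0 : 0 < K := by positivity
  set B : ℝ := R + K with hB
  have hB0 : 0 < B := by positivity
  set D : ℝ := l * B ^ (l - 1) * K with hD
  have hD0 : 0 ≤ D := by positivity
  refine ⟨D + 1, by positivity, fun m hm => ?_⟩
  have hm0 : (0 : ℝ) < m := by exact_mod_cast hm
  have hm1 : (1 : ℝ) ≤ m := by exact_mod_cast hm
  set g : ℂ → ℂ := fun y => (Complex.exp (a / m) * Complex.exp (y / m) - 1) ^ l with hg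
  have hgd : ContDiff ℂ j g := by
    rw [hg]
    fun_prop
  have hgdd : Differentiable ℂ g := by
    rw [hg]
    fun_prop
  have hp : iteratedDeriv j (fun y : ℂ => (a + y) ^ l) 0
      = l.descFactorial j * a ^ (l - j) := by
    have := iteratedDeriv_comp_const_add j (fun y : ℂ => y ^ l) a
    rw [this]
    simp [iteratedDeriv_pow]
  have hfd : iteratedDeriv j (fun y => (m : ℂ) ^ l * g y - (a + y) ^ l) 0
      = (m : ℂ) ^ l * iteratedDeriv j g 0 - l.descFactorial j * a ^ (l - j) := by
    rw [iteratedDeriv_fun_sub, hp, iteratedDeriv_const_mul_field]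
    · exact (contDiff_const.mul hgd).contDiffAt
    · apply ContDiff.contDiffAt
      fun_prop
  have hbound : ∀ y ∈ Metric.sphere (0 : ℂ) 1,
      ‖(m : ℂ) ^ l * g y - (a + y) ^ l‖ ≤ D / m := by
    intro y hy
    have hy1 : ‖y‖ = 1 := by simpa using hy
    have hz : ‖a + y‖ ≤ R := (norm_add_le _ _).trans (by rw [hy1])
    have h1 := aux_exp R m hm (a + y) hz
    have e : (m : ℂ) ^ l * g y = ((m : ℂ) * (Complex.exp ((a + y) / m) - 1)) ^ l := by
      rw [hg, mul_pow, add_div, Complex.exp_add]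
    rw [e]
    have hu : ‖(m : ℂ) * (Complex.exp ((a + y) / m) - 1)‖ ≤ B := by
      have := norm_le_norm_add_norm_sub' ((m : ℂ) * (Complex.exp ((a + y) / m) - 1)) (a + y)
      have h2 : K / m ≤ K := div_le_self hK0.le hm1
      linarith
    refine (aux_pow B hB0.le l _ _ hu (by linarith)).trans ?_
    rw [hD, mul_div_assoc]
    gcongr
  have hc := Complex.norm_iteratedDeriv_le_of_forall_mem_sphere_norm_le j one_pos
    (f := fun y => (m : ℂ) ^ l * g y - (a + y) ^ l) (c := 0)
    (Differentiable.diffContOnCl (by fun_prop)) hbound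
  rw [hfd] at hc
  have hj0 : (j.factorial : ℂ) ≠ 0 := by exact_mod_cast j.factorial_ne_zero
  have hjr : (0 : ℝ) < j.factorial := by exact_mod_cast j.factorial_pos
  have e2 : (m : ℂ) ^ l * ((1 / (j.factorial : ℂ)) * iteratedDeriv j g 0)
        - (l.choose j : ℂ) * a ^ (l - j)
      = (1 / (j.factorial : ℂ)) *
        ((m : ℂ) ^ l * iteratedDeriv j g 0 - l.descFactorial j * a ^ (l - j)) := by
    rw [Nat.descFactorial_eq_factorial_mul_choose]
    push_cast
    field_simp
  rw [e2, norm_mul]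
  have : ‖(1 / (j.factorial : ℂ))‖ = 1 / (j.factorial : ℝ) := by simp
  rw [this]
  calc _ ≤ 1 / (j.factorial : ℝ) * (j.factorial * (D / m) / 1 ^ j) := by gcongr
    _ = D / m := by field_simp; simp
    _ ≤ _ := by gcongr; linarith
end

section
/- Let d ≥ 1, let l = (l_1, …, l_d) be a d-tuple of non-negative integers and k = (k_1, …, k_d) a d-tuple of positive integers. For an integer m ≥ 2, set ζ_m = e^{2πi/m} and Z_{m−1}(l; k) = Σ_{m−1 ≥ m_1 > ⋯ > m_d ≥ 1} Π_{a=1}^{d} (m_a/m)^{l_a} · (−2πi/m)^{k_a} · ζ_m^{(k_a−1) m_a} / (1 − ζ_m^{m_a})^{k_a} ∈ ℂ. Then there exists a constant C > 0 such that |Z_{m−1}(l; k)| ≤ C · (log m)^d for all integers m ≥ 2. -/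
open Finset

/-- The nested sum
`Z m M L = Σ_{M ≥ m₁ > m₂ > ⋯ > m_d ≥ 1} Π_{a} (m_a/m)^{l_a} (−2πi/m)^{k_a}
ζ_m^{(k_a−1)m_a} / (1 − ζ_m^{m_a})^{k_a}`
where `L = [(l₁,k₁), …, (l_d,k_d)]` and `ζ_m = e^{2πi/m}`. -/
noncomputable def Zsum (m : ℕ) : ℕ → List (ℕ × ℕ) → ℂ
  | _, [] => 1
  | M, (l, k) :: rest => ∑ i ∈ Finset.Icc 1 M,
      ((i : ℂ) / (m : ℂ)) ^ l * (-(2 * Real.pi * Complex.I) / (m : ℂ)) ^ k *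
        Complex.exp (2 * Real.pi * Complex.I / m) ^ ((k - 1) * i) /
        (1 - Complex.exp (2 * Real.pi * Complex.I / m) ^ i) ^ k *
        Zsum m (i - 1) rest


lemma aux_norm (m i : ℕ) : ‖Complex.exp (2 * Real.pi * Complex.I / m) ^ i‖ = 1 := by
  have h : (2 * Real.pi * Complex.I / m : ℂ) = ((2 * Real.pi / m : ℝ) : ℂ) * Complex.I := by
    push_cast; ring
  rw [norm_pow, h, Complex.norm_exp_ofReal_mul_I, one_pow]

lemma aux_sin (m i : ℕ) (hi : 1 ≤ i) (him : i < m) :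
    ‖1 - Complex.exp (2 * Real.pi * Complex.I / m) ^ i‖ = 2 * Real.sin (Real.pi * i / m) := by
  have hm : (0 : ℝ) < m := by exact_mod_cast (by omega : 0 < m)
  have him' : (i : ℝ) < m := by exact_mod_cast him
  have h : (i * (2 * Real.pi * Complex.I / m) : ℂ) =
      Complex.I * ((2 * Real.pi * i / m : ℝ) : ℂ) := by
    push_cast; ring
  rw [← Complex.exp_nat_mul, h, norm_sub_rev, Complex.norm_exp_I_mul_ofReal_sub_one,
    show 2 * Real.pi * i / m / 2 = Real.pi * i / m by ring, Real.norm_eq_abs, abs_of_nonneg]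
  refine mul_nonneg (by norm_num) (Real.sin_nonneg_of_nonneg_of_le_pi (by positivity) ?_)
  rw [div_le_iff₀ hm]
  exact mul_le_mul_of_nonneg_left him'.le Real.pi_pos.le

lemma aux_lower (m i : ℕ) (hi : 1 ≤ i) (him : i < m) :
    ∃ n : ℝ, 1 ≤ n ∧ 1 / n ≤ 1 / (i : ℝ) + 1 / ((m - i : ℕ) : ℝ) ∧
      4 * n / m ≤ ‖1 - Complex.exp (2 * Real.pi * Complex.I / m) ^ i‖ := by
  have hm : (0 : ℝ) < m := by exact_mod_cast (by omega : 0 < m)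
  have hpi := Real.pi_pos
  rw [aux_sin m i hi him]
  have key : ∀ x : ℝ, 0 ≤ x → 2 * x ≤ m → 4 * x / m ≤ 2 * Real.sin (Real.pi * x / m) := by
    intro x hx hxm
    have := Real.mul_le_sin (x := Real.pi * x / m) (by positivity) (by
      rw [div_le_div_iff₀ hm (by norm_num)]; nlinarith)
    have e : 2 / Real.pi * (Real.pi * x / m) = 2 * x / m := by field_simp
    rw [e] at this
    calc 4 * x / m = 2 * (2 * x / m) := by ring
      _ ≤ _ := by linarith
  by_cases h : 2 * i ≤ m
  · refine ⟨i, by exact_mod_cast hi, ?_, key i (by positivity) (by exact_mod_cast h)⟩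
    have : (0 : ℝ) ≤ 1 / ((m - i : ℕ) : ℝ) := by positivity
    linarith
  · refine ⟨(m - i : ℕ), by exact_mod_cast (by omega : 1 ≤ m - i), ?_, ?_⟩
    · have : (0 : ℝ) ≤ 1 / (i : ℝ) := by positivity
      linarith
    · have := key (m - i : ℕ) (by positivity) (by exact_mod_cast (by omega : 2 * (m - i) ≤ m))
      rw [← Real.sin_pi_sub (Real.pi * i / m)]
      convert this using 3
      rw [Nat.cast_sub him.le]
      field_simp

lemma aux_term (m i l k : ℕ) (hk : 1 ≤ k) (hi : 1 ≤ i) (him : i < m) :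
    ‖((i : ℂ) / (m : ℂ)) ^ l * (-(2 * Real.pi * Complex.I) / (m : ℂ)) ^ k *
        Complex.exp (2 * Real.pi * Complex.I / m) ^ ((k - 1) * i) /
        (1 - Complex.exp (2 * Real.pi * Complex.I / m) ^ i) ^ k‖ ≤
      (Real.pi / 2) ^ k * (1 / (i : ℝ) + 1 / ((m - i : ℕ) : ℝ)) := by
  have hm : (0 : ℝ) < m := by exact_mod_cast (by omega : 0 < m)
  have him' : (i : ℝ) ≤ m := by exact_mod_cast him.le
  have hpi := Real.pi_pos
  obtain ⟨n, hn1, hn2, hn3⟩ := aux_lower m i hi him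
  have hn0 : 0 < n := by linarith
  rw [norm_div, norm_mul, norm_mul, aux_norm, mul_one, norm_pow, norm_pow, norm_pow, mul_div_assoc,
    ← div_pow]
  have h1 : ‖((i : ℂ) / (m : ℂ))‖ ≤ 1 := by
    rw [norm_div, Complex.norm_natCast, Complex.norm_natCast]
    exact div_le_one_of_le₀ him' hm.le
  have h2 : ‖-(2 * Real.pi * Complex.I) / (m : ℂ)‖ = 2 * Real.pi / m := by
    simp [abs_of_pos hpi]
  rw [h2]
  set D := ‖1 - Complex.exp (2 * Real.pi * Complex.I / m) ^ i‖
  have h3 : 2 * Real.pi / m / D ≤ Real.pi / 2 * (1 / n) := by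
    calc 2 * Real.pi / m / D ≤ 2 * Real.pi / m / (4 * n / m) :=
          div_le_div_of_nonneg_left (by positivity) (by positivity) hn3
      _ = _ := by field_simp; norm_num
  have h4 : (1 / n) ^ k ≤ 1 / n := by
    apply pow_le_of_le_one (by positivity) _ (by omega)
    exact div_le_one_of_le₀ hn1 hn0.le
  calc _ ≤ 1 * (Real.pi / 2 * (1 / n)) ^ k := by
        apply mul_le_mul (pow_le_one₀ (norm_nonneg _) h1) _ (by positivity) zero_le_one
        exact pow_le_pow_left₀ (by positivity) h3 k
    _ = (Real.pi / 2) ^ k * (1 / n) ^ k := by rw [one_mul, mul_pow]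
    _ ≤ _ := mul_le_mul_of_nonneg_left (h4.trans hn2) (by positivity)

lemma aux_harm (m : ℕ) (hm : 2 ≤ m) :
    ∑ i ∈ Finset.Icc 1 (m - 1), (1 / (i : ℝ) + 1 / ((m - i : ℕ) : ℝ)) ≤
      2 * (1 + 1 / Real.log 2) * Real.log m := by
  have e : ∑ i ∈ Finset.Icc 1 (m - 1), 1 / ((m - i : ℕ) : ℝ) =
      ∑ i ∈ Finset.Icc 1 (m - 1), 1 / (i : ℝ) := by
    apply Finset.sum_nbij' (fun i => m - i) (fun i => m - i)
    all_goals simp only [Finset.mem_Icc]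
    · intro a h; omega
    · intro a h; omega
    · intro a h; omega
    · intro a h; omega
    · intro a h; trivial
  have h := harmonic_le_one_add_log (m - 1)
  rw [harmonic_eq_sum_Icc] at h
  push_cast at h
  have hl2 : 0 < Real.log 2 := Real.log_pos (by norm_num)
  have hl : Real.log 2 ≤ Real.log m := Real.log_le_log (by norm_num) (by exact_mod_cast hm)
  have hl' : Real.log (m - 1 : ℕ) ≤ Real.log m :=
    Real.log_le_log (by exact_mod_cast (by omega : 0 < m - 1)) (by exact_mod_cast (by omega))
  have h1 : 1 ≤ 1 / Real.log 2 * Real.log m := by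
    rw [one_div_mul_eq_div, le_div_iff₀ hl2]; linarith
  rw [Finset.sum_add_distrib, e]
  simp only [one_div] at h h1 ⊢
  nlinarith

lemma aux_main (L : List (ℕ × ℕ)) (hL : ∀ p ∈ L, 1 ≤ p.2) :
    ∃ C : ℝ, 0 < C ∧ ∀ m : ℕ, 2 ≤ m → ∀ M : ℕ, M ≤ m - 1 →
      ‖Zsum m M L‖ ≤ C * (Real.log m) ^ L.length := by
  induction L with
  | nil => exact ⟨1, one_pos, fun m hm M hM => by simp [Zsum]⟩
  | cons p rest ih =>
    obtain ⟨l, k⟩ := p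
    obtain ⟨C, hC, h⟩ := ih (fun p hp => hL p (List.mem_cons_of_mem _ hp))
    have hk : 1 ≤ k := hL (l, k) List.mem_cons_self
    have hpi := Real.pi_pos
    have hl2 : 0 < Real.log 2 := Real.log_pos (by norm_num)
    refine ⟨(Real.pi / 2) ^ k * (2 * (1 + 1 / Real.log 2)) * C, by positivity, ?_⟩
    intro m hm M hM
    have hlm : 0 ≤ Real.log m := Real.log_natCast_nonneg m
    rw [Zsum]
    calc _ ≤ ∑ i ∈ Finset.Icc 1 M, ((Real.pi / 2) ^ k * (1 / (i : ℝ) + 1 / ((m - i : ℕ) : ℝ))) *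
            (C * (Real.log m) ^ rest.length) := by
          refine (norm_sum_le _ _).trans (Finset.sum_le_sum fun i hi => ?_)
          rw [Finset.mem_Icc] at hi
          rw [norm_mul]
          exact mul_le_mul (aux_term m i l k hk hi.1 (by omega)) (h m hm _ (by omega))
            (norm_nonneg _) (by positivity)
      _ ≤ ∑ i ∈ Finset.Icc 1 (m - 1),
            ((Real.pi / 2) ^ k * (1 / (i : ℝ) + 1 / ((m - i : ℕ) : ℝ))) *
            (C * (Real.log m) ^ rest.length) := by
          apply Finset.sum_le_sum_of_subset_of_nonneg
          · exact Finset.Icc_subset_Icc_right hM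
          · intros; positivity
      _ = (Real.pi / 2) ^ k * (∑ i ∈ Finset.Icc 1 (m - 1),
            (1 / (i : ℝ) + 1 / ((m - i : ℕ) : ℝ))) * (C * (Real.log m) ^ rest.length) := by
          rw [← Finset.sum_mul, ← Finset.mul_sum]
      _ ≤ (Real.pi / 2) ^ k * (2 * (1 + 1 / Real.log 2) * Real.log m) *
            (C * (Real.log m) ^ rest.length) := by
          have := aux_harm m hm
          gcongr
      _ = _ := by rw [List.length_cons]; ring

/-- Lemma A.6 of the paper: `Z_{m−1}(l; k) = O((log m)^d)` as `m → ∞`. -/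
theorem stmt14 (d : ℕ) (hd : 1 ≤ d) (l : Fin d → ℕ) (k : Fin d → ℕ) (hk : ∀ i, 1 ≤ k i) :
    ∃ C : ℝ, 0 < C ∧ ∀ m : ℕ, 2 ≤ m →
      ‖Zsum m (m - 1) (List.ofFn (fun i => (l i, k i)))‖ ≤
        C * (Real.log m) ^ d := by
  obtain ⟨C, hC, h⟩ := aux_main (List.ofFn (fun i => (l i, k i))) (by
    intro p hp
    rw [List.mem_ofFn] at hp
    obtain ⟨i, rfl⟩ := hp
    exact hk i)
  refine ⟨C, hC, fun m hm => ?_⟩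
  have := h m hm (m - 1) le_rfl
  rwa [List.length_ofFn] at this
end

section
/- Let p be a prime, n ≥ 1, and let k be an index of weight w. Set D = Π_{m=1}^{p−1} [m]_q^{w} ∈ ℤ[q]. Let • ∈ {non-star, star} and let G(q) denote any one of H•_{p−1}(k; q) or H̄•_{p−1}(k; q); then D·G(q) is a polynomial. If f ∈ ℚ[q] has all coefficients in ℤ_{(p)} and [p]^n divides D·f − D·G(q) in ℚ[q], then f(1) − H•_{p−1}(k) lies in p^n ℤ_{(p)}. -/
open Finset

/-- Multiple harmonic sum `H_m(k)` / `H⋆_m(k)`. -/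
noncomputable def MHS (star : Bool) : ℕ → List ℕ → ℚ
  | _, [] => 1
  | m, k :: ks => ∑ i ∈ Finset.Icc 1 m,
      (1 / (i : ℚ) ^ k) * MHS star (if star then i else i - 1) ks

/-- The denominator-clearing polynomial `D = Π_{m=1}^{p−1} [m]^w`. -/
noncomputable def Dpoly (p w : ℕ) : Polynomial ℚ := ∏ m ∈ Finset.Icc 1 (p - 1), qiP m ^ w

/-- The `q`-integer over `ℤ`. -/
noncomputable def qiZ (N : ℕ) : Polynomial ℤ := ∑ i ∈ Finset.range N, Polynomial.X ^ i

/-- The denominator over `ℤ`. -/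
noncomputable def DZ (M w : ℕ) : Polynomial ℤ := ∏ m ∈ Finset.Icc 1 M, qiZ m ^ w

/-- The embedding of `ℤ[q]` into `ℚ(q)`. -/
noncomputable def embZ : Polynomial ℤ →+* RatFunc ℚ :=
  (algebraMap (Polynomial ℚ) (RatFunc ℚ)).comp (Polynomial.mapRingHom (Int.castRingHom ℚ))

theorem qiZ_map (N : ℕ) : (qiZ N).map (Int.castRingHom ℚ) = qiP N := by
  simp [qiZ, qiP, Polynomial.map_sum]

theorem DZ_map (p w : ℕ) : (DZ (p - 1) w).map (Int.castRingHom ℚ) = Dpoly p w := by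
  simp [DZ, Dpoly, Polynomial.map_prod, qiZ_map]

theorem embZ_X : embZ Polynomial.X = RatFunc.X := by
  simp [embZ]

theorem embZ_qiZ (N : ℕ) : embZ (qiZ N) = qiR N := by
  simp [qiZ, qiR, embZ_X]

theorem qiZ_eval (N : ℕ) : (qiZ N).eval 1 = N := by
  simp [qiZ, Polynomial.eval_finset_sum]

theorem embZ_injective : Function.Injective embZ := by
  have h1 := RatFunc.algebraMap_injective ℚ
  have h2 := Polynomial.map_injective (Int.castRingHom ℚ) Int.cast_injective
  exact h1.comp h2

theorem qiZ_ne_zero {i : ℕ} (hi : 1 ≤ i) : qiZ i ≠ 0 := by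
  intro h
  have := qiZ_eval i
  rw [h] at this
  simp at this
  omega

theorem key (star : Bool) (num : ℕ → ℕ → ℕ) (M : ℕ) (k : List ℕ) :
    ∀ m ≤ M, ∃ P : Polynomial ℤ, embZ (DZ M k.sum) * MHqS star num m k = embZ P ∧
      ((P.eval 1 : ℤ) : ℚ) = (((DZ M k.sum).eval 1 : ℤ) : ℚ) * MHS star m k := by
  induction k with
  | nil =>
    intro m _
    exact ⟨1, by simp [MHqS, DZ], by simp [MHS, DZ]⟩
  | cons a ks ih =>
    intro m hm
    have hlt : ∀ i ∈ Finset.Icc 1 m, (if star then i else i - 1) ≤ M := by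
      intro i hi
      rw [Finset.mem_Icc] at hi
      split_ifs <;> omega
    have hex : ∀ i, ∃ P : Polynomial ℤ, i ∈ Finset.Icc 1 m →
        embZ (DZ M ks.sum) * MHqS star num (if star then i else i - 1) ks = embZ P ∧
        ((P.eval 1 : ℤ) : ℚ) = (((DZ M ks.sum).eval 1 : ℤ) : ℚ) *
          MHS star (if star then i else i - 1) ks := by
      intro i
      by_cases hi : i ∈ Finset.Icc 1 m
      · obtain ⟨P, hP⟩ := ih _ (hlt i hi)
        exact ⟨P, fun _ => hP⟩
      · exact ⟨0, fun h => absurd h hi⟩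
    choose Q hQ using hex
    have hD : DZ M (a :: ks).sum = DZ M a * DZ M ks.sum := by
      simp [DZ, pow_add, Finset.prod_mul_distrib]
    have hR : ∀ i ∈ Finset.Icc 1 m,
        DZ M a = qiZ i ^ a * ∏ j ∈ (Finset.Icc 1 M).erase i, qiZ j ^ a := by
      intro i hi
      rw [DZ, Finset.mul_prod_erase (Finset.Icc 1 M) (fun j => qiZ j ^ a)]
      rw [Finset.mem_Icc] at hi ⊢
      omega
    refine ⟨∑ i ∈ Finset.Icc 1 m, Polynomial.X ^ (num a i) *
      (∏ j ∈ (Finset.Icc 1 M).erase i, qiZ j ^ a) * Q i, ?_, ?_⟩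
    · rw [MHqS, hD, Finset.mul_sum, map_sum]
      refine Finset.sum_congr rfl fun i hi => ?_
      have hne : qiR i ≠ 0 := by
        rw [← embZ_qiZ, map_ne_zero_iff _ embZ_injective]
        exact qiZ_ne_zero (Finset.mem_Icc.1 hi).1
      rw [map_mul embZ (DZ M a), hR i hi, map_mul embZ (_ * _) (Q i), ← (hQ i hi).1]
      simp only [map_mul, map_pow, embZ_X, embZ_qiZ]
      field_simp
    · rw [MHS, hD, Finset.mul_sum, Polynomial.eval_finset_sum, Int.cast_sum]
      refine Finset.sum_congr rfl fun i hi => ?_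
      have hne : (i : ℚ) ≠ 0 := by
        have := (Finset.mem_Icc.1 hi).1
        positivity
      rw [Polynomial.eval_mul, Int.cast_mul, (hQ i hi).2, hR i hi]
      simp only [Polynomial.eval_mul, Polynomial.eval_pow, Polynomial.eval_X, qiZ_eval,
        one_pow, one_mul, Int.cast_mul, Int.cast_pow, Int.cast_natCast]
      field_simp

theorem clear_den (p : ℕ) (hp : p.Prime) (f : Polynomial ℚ)
    (hf : ∀ i, ¬ (p ∣ (f.coeff i).den)) :
    ∃ (b : ℤ) (F : Polynomial ℤ), ¬ ((p : ℤ) ∣ b) ∧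
      F.map (Int.castRingHom ℚ) = Polynomial.C (b : ℚ) * f := by
  let b : ℕ := ∏ i ∈ f.support, (f.coeff i).den
  have hb : ¬ p ∣ b := by
    intro h
    obtain ⟨i, _, hi⟩ := (hp.prime.dvd_finset_prod_iff _).1 h
    exact hf i hi
  have hl : Polynomial.C (b : ℚ) * f ∈ Polynomial.lifts (Int.castRingHom ℚ) := by
    rw [Polynomial.lifts_iff_coeff_lifts]
    intro i
    rw [Polynomial.coeff_C_mul]
    by_cases hi : i ∈ f.support
    · obtain ⟨c, hc⟩ : (f.coeff i).den ∣ b :=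
        Finset.dvd_prod_of_mem (fun i => (f.coeff i).den) hi
      refine ⟨c * (f.coeff i).num, ?_⟩
      rw [hc]
      have := Rat.mul_den_eq_num (f.coeff i)
      simp only [eq_intCast, Int.cast_mul, Int.cast_natCast, Nat.cast_mul]
      rw [← this]
      ring
    · rw [Polynomial.notMem_support_iff.1 hi]
      exact ⟨0, by simp⟩
  obtain ⟨F, hF⟩ := (Polynomial.mem_lifts _).1 hl
  exact ⟨b, F, by exact_mod_cast hb, by simpa using hF⟩

theorem qiZ_monic {p : ℕ} (hp : 1 ≤ p) : (qiZ p).Monic := by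
  exact Polynomial.monic_geom_sum_X (by omega)

/-- `G(q)` is any of `H•_{p−1}(k; q)` or `H̄•_{p−1}(k; q)` (`bar`, `star` booleans).
Then (i) `D·G(q)` is a polynomial, and (ii) if `f ∈ ℚ[q]` has all coefficients in `ℤ_{(p)}`
and `[p]^n ∣ D·f − D·G(q)` in `ℚ[q]`, then `f(1) − H•_{p−1}(k) ∈ p^n ℤ_{(p)}`. -/
theorem stmt16 (p : ℕ) (hp : p.Prime) (n : ℕ) (hn : 1 ≤ n)
    (k : List ℕ) (hk : ∀ x ∈ k, 1 ≤ x) (star bar : Bool) :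
    (∃ P : Polynomial ℚ,
        algebraMap (Polynomial ℚ) (RatFunc ℚ) (Dpoly p k.sum) *
            MHqS star (if bar then barNum else stdNum) (p - 1) k =
          algebraMap (Polynomial ℚ) (RatFunc ℚ) P) ∧
      ∀ f P : Polynomial ℚ,
        (∀ i, ¬ (p ∣ (f.coeff i).den)) →
        algebraMap (Polynomial ℚ) (RatFunc ℚ) (Dpoly p k.sum) *
            MHqS star (if bar then barNum else stdNum) (p - 1) k =
          algebraMap (Polynomial ℚ) (RatFunc ℚ) P →
        (qiP p) ^ n ∣ Dpoly p k.sum * f - P →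
        ∃ a b : ℤ, ¬ ((p : ℤ) ∣ b) ∧
          (f.eval 1 - MHS star (p - 1) k) * b = p ^ n * a := by
  obtain ⟨P₀, hP₀, hev⟩ :=
    key star (if bar then barNum else stdNum) (p - 1) k (p - 1) le_rfl
  have hDe : embZ (DZ (p - 1) k.sum) =
      algebraMap (Polynomial ℚ) (RatFunc ℚ) (Dpoly p k.sum) := by
    rw [← DZ_map]; rfl
  rw [hDe] at hP₀
  refine ⟨⟨_, hP₀⟩, ?_⟩
  intro f P hf hP hdvd
  have hPP : P = P₀.map (Int.castRingHom ℚ) := by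
    apply RatFunc.algebraMap_injective ℚ
    rw [← hP, hP₀]; rfl
  obtain ⟨b, F, hb, hF⟩ := clear_den p hp f hf
  have hd : (qiZ p ^ n) ∣ DZ (p - 1) k.sum * F - Polynomial.C b * P₀ := by
    rw [← Polynomial.map_dvd_map (Int.castRingHom ℚ) Int.cast_injective
      ((qiZ_monic hp.one_le).pow n)]
    rw [Polynomial.map_pow, qiZ_map, Polynomial.map_sub, Polynomial.map_mul, DZ_map, hF,
      Polynomial.map_mul, ← hPP, Polynomial.map_C]
    refine (hdvd.mul_left (Polynomial.C (b : ℚ))).trans (dvd_of_eq ?_)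
    simp only [eq_intCast]
    ring
  obtain ⟨g, hg⟩ := hd
  have hg1 := congrArg (fun t => ((t.eval 1 : ℤ) : ℚ)) hg
  have hF1 := congrArg (fun t => t.eval (1 : ℚ)) hF
  have hF2 : ((F.eval 1 : ℤ) : ℚ) = b * f.eval 1 := by
    simpa [Polynomial.eval_one_map] using hF1
  refine ⟨g.eval 1, b * (DZ (p - 1) k.sum).eval 1, ?_, ?_⟩
  · have hpp : Prime (p : ℤ) := Nat.prime_iff_prime_int.1 hp
    intro h
    rcases hpp.dvd_or_dvd h with h | h
    · exact hb h
    · rw [DZ, Polynomial.eval_prod, hpp.dvd_finset_prod_iff] at h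
      obtain ⟨i, hi, h⟩ := h
      rw [Polynomial.eval_pow, qiZ_eval] at h
      have h2 := Int.natCast_dvd_natCast.1 (hpp.dvd_of_dvd_pow h)
      rw [Finset.mem_Icc] at hi
      have := Nat.le_of_dvd (by omega) h2
      omega
  · simp only [Polynomial.eval_sub, Polynomial.eval_mul, Polynomial.eval_pow, Polynomial.eval_C,
      qiZ_eval, Int.cast_sub, Int.cast_mul, Int.cast_pow, Int.cast_natCast, hF2, hev] at hg1
    push_cast
    linear_combination hg1
end
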